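/- arXiv:0706.1890 — 9 statements merged into one kernel-verified Lean document; each statement's English description precedes it below -/
import Mathlib

section
/- Let 1 ≤ P < L and 0 < v < 1/2. For any two configurations X and Y of P particles on the ring of L sites, F_L(X, Y, 0) = (1−v)^{N_c(X)−P} if X = Y, and F_L(X, Y, 0) = 0 if X ≠ Y. (This is the resolution of the identity operator evaluated in the configurational basis.) -/
open Classical

/-- `f(a,b,t)` from the paper: `(1+λ)^{-t} (2πi)^{-1} ∮_{|z|=r} (1+λz)^{t+a}(z-1)^{-a}z^{a-b-1} dz`. -/
noncomputable def fInt (lam r : ℝ) (a b : ℤ) (t : ℕ) : ℂ :=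
  ((1 : ℂ) + (lam : ℂ)) ^ (-(t : ℤ)) *
    ((2 * (Real.pi : ℂ) * Complex.I)⁻¹ *
      ∮ z in C(0, r), (1 + (lam : ℂ) * z) ^ ((t : ℤ) + a) * (z - 1) ^ (-a) * z ^ (a - b - 1))

/-- A configuration of `P` particles on a ring of `L` sites: `1 ≤ x₁ < x₂ < ⋯ < x_P ≤ L`. -/
def IsConfig (L P : ℕ) (X : Fin P → ℤ) : Prop :=
  StrictMono X ∧ ∀ i, 1 ≤ X i ∧ X i ≤ L

/- Number of clusters: the number of particles whose cyclic successor site is empty. -/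
noncomputable def Nc (L : ℕ) {P : ℕ} (X : Fin P → ℤ) : ℕ :=
  (Finset.univ.filter fun i : Fin P =>
    ∀ j : Fin P, X j ≠ (if X i = (L : ℤ) then 1 else X i + 1)).card

/-- The cyclic successor of a site on the ring of `L` sites. -/
def succSite (L : ℕ) (s : ℤ) : ℤ := if s = (L : ℤ) then 1 else s + 1

/-- `F_L(X,Y,t)`: the `P`-tuple sum of determinants. -/
noncomputable def FL (lam r : ℝ) (L : ℕ) {P : ℕ} (X Y : Fin P → ℤ) (t : ℕ) : ℂ :=
  ∑' n : Fin P → ℤ,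
    (-1 : ℂ) ^ (((P : ℤ) - 1) * ∑ i, n i) *
      Matrix.det (Matrix.of fun i j : Fin P =>
        fInt lam r (((i : ℕ) : ℤ) - ((j : ℕ) : ℤ) + (P : ℤ) * n i - ∑ k, n k)
          (X i - Y j + n i * L) t)


lemma aux_sum_mod {P : ℕ} (hP : 0 < P) (c : Fin P → ℤ)
    (hc : Function.Injective fun i => c i % (P : ℤ)) :
    ∑ i, c i % (P : ℤ) = ∑ x ∈ Finset.Ico (0 : ℤ) P, x := by
  have hP' : (0 : ℤ) < P := by exact_mod_cast hP
  have h1 : Finset.univ.image (fun i => c i % (P : ℤ)) = Finset.Ico (0 : ℤ) P := by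
    apply Finset.eq_of_subset_of_card_le
    · intro x hx
      simp only [Finset.mem_image, Finset.mem_univ, true_and] at hx
      obtain ⟨i, rfl⟩ := hx
      simp [Int.emod_nonneg _ hP'.ne', Int.emod_lt_of_pos _ hP']
    · rw [Finset.card_image_of_injective _ hc]; simp
  rw [← h1, Finset.sum_image (fun a _ b _ h => hc h)]

lemma inj_shift {P : ℕ} (c : Fin P → ℤ) (s : ℤ)
    (hc : Function.Injective fun i => c i % (P : ℤ)) :
    Function.Injective fun i => (c i - s) % (P : ℤ) := by
  intro i j h
  apply hc
  have h' : c i - s ≡ c j - s [ZMOD P] := h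
  have := Int.ModEq.add_right s h'
  have h2 : c i ≡ c j [ZMOD P] := by simpa using this
  exact h2

lemma sum_div_eq {P : ℕ} (hP : 0 < P) (c d : Fin P → ℤ)
    (hc : Function.Injective fun i => c i % (P : ℤ))
    (hd : Function.Injective fun i => d i % (P : ℤ))
    (hcd : ∑ i, c i = ∑ i, d i) (s : ℤ) :
    ∑ i, (c i - s) / (P : ℤ) = ∑ i, (d i - s) / (P : ℤ) := by
  have hP' : (0 : ℤ) < P := by exact_mod_cast hP
  have key : ∀ c : Fin P → ℤ, Function.Injective (fun i => c i % (P : ℤ)) →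
      (P : ℤ) * ∑ i, (c i - s) / (P : ℤ) = ∑ i, c i - ∑ i : Fin P, s
        - ∑ x ∈ Finset.Ico (0 : ℤ) P, x := by
    intro c hc
    rw [← aux_sum_mod hP (fun i => c i - s) (inj_shift c s hc), Finset.mul_sum,
      ← Finset.sum_sub_distrib, ← Finset.sum_sub_distrib]
    apply Finset.sum_congr rfl
    intro i _
    have := Int.mul_ediv_add_emod (c i - s) P
    linarith
  have := key c hc
  have h2 := key d hd
  apply mul_left_cancel₀ hP'.ne'
  rw [this, h2, hcd]

/-- cut lemma -/
lemma cut_lemma {P : ℕ} (hP : 0 < P) (c d : Fin P → ℤ)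
    (hc : Function.Injective fun i => c i % (P : ℤ))
    (hd : Function.Injective fun i => d i % (P : ℤ))
    (hcd : ∑ i, c i = ∑ i, d i) (C : ℤ) (i : Fin P) (h1 : c i ≤ C) (h2 : C < d i) :
    ∃ i k, d i + k * P ≤ C ∧ C < c i + k * P := by
  have hP' : (0 : ℤ) < P := by exact_mod_cast hP
  have hs := sum_div_eq hP c d hc hd hcd (C + 1)
  by_contra! hcon
  have hle : ∀ i ∈ Finset.univ, (c i - (C + 1)) / (P : ℤ) ≤ (d i - (C + 1)) / (P : ℤ) := by
    intro i _
    by_contra! hlt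
    have := hcon i (-((c i - (C + 1)) / (P : ℤ)))
    have e1 := Int.mul_ediv_add_emod (c i - (C + 1)) P
    have e2 := Int.emod_nonneg (c i - (C + 1)) hP'.ne'
    have e3 := Int.mul_ediv_add_emod (d i - (C + 1)) P
    have e4 := Int.emod_lt_of_pos (d i - (C + 1)) hP'
    have := this (by nlinarith)
    nlinarith
  have hlt : ∑ i, (c i - (C + 1)) / (P : ℤ) < ∑ i, (d i - (C + 1)) / (P : ℤ) := by
    apply Finset.sum_lt_sum hle ⟨i, Finset.mem_univ _, ?_⟩
    have a1 : (c i - (C + 1)) / (P : ℤ) < 0 := Int.ediv_neg_of_neg_of_pos (by linarith) hP'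
    have a2 : 0 ≤ (d i - (C + 1)) / (P : ℤ) := Int.ediv_nonneg (by linarith) hP'.le
    linarith
  omega

lemma per_mul {U : ℤ → ℤ} {P D : ℤ} (h : ∀ c, U (c + P) = U c + D) (c k : ℤ) :
    U (c + k * P) = U c + k * D := by
  induction k using Int.induction_on with
  | zero => simp
  | succ k ih =>
    have := h (c + k * P)
    rw [show c + ((k : ℤ) + 1) * P = c + k * P + P by ring, this, ih]; ring
  | pred k ih =>
    have := h (c + (-(k : ℤ) - 1) * P)
    rw [show c + (-(k : ℤ) - 1) * P + P = c + -(k : ℤ) * P by ring, ih] at this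
    linarith

lemma key_comb {P : ℕ} (hP : 0 < P) (U W : ℤ → ℤ) (D : ℤ) (hU : Monotone U) (hW : Monotone W)
    (hUp : ∀ c, U (c + P) = U c + D) (hWp : ∀ c, W (c + P) = W c + D)
    (c d : Fin P → ℤ)
    (hc : Function.Injective fun i => c i % (P : ℤ))
    (hd : Function.Injective fun i => d i % (P : ℤ))
    (hcd : ∑ i, c i = ∑ i, d i)
    (H1 : ∀ i, d i ≤ c i → U (c i) ≤ W (d i))
    (H2 : ∀ i, c i ≤ d i → W (d i) ≤ U (c i)) (i : Fin P) : U (d i) = W (d i) := by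
  rcases lt_trichotomy (U (d i)) (W (d i)) with h | h | h
  · exfalso
    have h1 : d i < c i := by
      by_contra! hh
      have := H2 i hh
      have := hU hh
      omega
    obtain ⟨j, k, h3, h4⟩ := cut_lemma hP d c hd hc hcd.symm (d i) i le_rfl h1
    have h5 := H2 j (by linarith)
    have h6 := hU h3
    have h7 := hW h4.le
    rw [per_mul hUp] at h6
    rw [per_mul hWp] at h7
    linarith
  · exact h
  · exfalso
    have h1 : c i < d i := by
      by_contra! hh
      have := H1 i hh
      have := hU hh
      omega
    obtain ⟨j, k, h3, h4⟩ := cut_lemma hP c d hc hd hcd (d i - 1) i (by omega) (by omega)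
    have h5 := H1 j (by linarith)
    have h6 := hW (show d j + k * P ≤ d i by omega)
    have h7 := hU (show d i ≤ c j + k * P by omega)
    rw [per_mul hUp] at h7
    rw [per_mul hWp] at h6
    linarith

/-- periodic extension -/
def xext (L : ℕ) {P : ℕ} (hP : 0 < P) (X : Fin P → ℤ) (m : ℤ) : ℤ :=
  X ⟨(m % P).toNat, by
    have hP' : (0 : ℤ) < P := by exact_mod_cast hP
    have e2 := Int.emod_nonneg m hP'.ne'
    have e4 := Int.emod_lt_of_pos m hP'
    omega⟩ + m / P * L

lemma xext_add (L : ℕ) {P : ℕ} (hP : 0 < P) (X : Fin P → ℤ) (i : Fin P) (k : ℤ) :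
    xext L hP X ((i : ℕ) + P * k) = X i + k * L := by
  have hP' : (0 : ℤ) < P := by exact_mod_cast hP
  have hi : ((i : ℕ) : ℤ) < P := by exact_mod_cast i.2
  have h1 : (((i : ℕ) : ℤ) + P * k) % P = (i : ℕ) := by
    rw [Int.add_mul_emod_self_left, Int.emod_eq_of_lt (by positivity) hi]
  have h2 : (((i : ℕ) : ℤ) + P * k) / P = k := by
    rw [Int.add_mul_ediv_left _ _ hP'.ne', Int.ediv_eq_zero_of_lt (by positivity) hi, zero_add]
  unfold xext
  rw [h2]
  congr 2
  apply Fin.ext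
  simp [h1]

lemma exists_rep {P : ℕ} (hP : 0 < P) (m : ℤ) : ∃ (i : Fin P) (k : ℤ), m = (i : ℕ) + P * k := by
  have hP' : (0 : ℤ) < P := by exact_mod_cast hP
  have e2 := Int.emod_nonneg m hP'.ne'
  have e4 := Int.emod_lt_of_pos m hP'
  refine ⟨⟨(m % P).toNat, by omega⟩, m / P, ?_⟩
  have := Int.mul_ediv_add_emod m P
  simp only [Int.toNat_of_nonneg e2]
  omega

lemma xext_per (L : ℕ) {P : ℕ} (hP : 0 < P) (X : Fin P → ℤ) (m : ℤ) :
    xext L hP X (m + P) = xext L hP X m + L := by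
  obtain ⟨i, k, rfl⟩ := exists_rep hP m
  rw [show ((i : ℕ) : ℤ) + P * k + P = (i : ℕ) + P * (k + 1) by ring, xext_add, xext_add]
  ring

lemma xext_succ (L : ℕ) {P : ℕ} (hP : 0 < P) (X : Fin P → ℤ) (hX : IsConfig L P X) (m : ℤ) :
    xext L hP X m + 1 ≤ xext L hP X (m + 1) := by
  obtain ⟨i, k, rfl⟩ := exists_rep hP m
  by_cases h : (i : ℕ) + 1 < P
  · have := xext_add L hP X ⟨i + 1, h⟩ k
    rw [show ((i : ℕ) : ℤ) + P * k + 1 = (((⟨i + 1, h⟩ : Fin P) : ℕ) : ℤ) + P * k by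
      push_cast; ring, this, xext_add]
    have h3 : X i < X ⟨i + 1, h⟩ := hX.1 (by rw [Fin.lt_def]; simp)
    linarith
  · have h3 : ((i : ℕ) : ℤ) + 1 = P := by have := i.2; omega
    have := xext_add L hP X ⟨0, hP⟩ (k + 1)
    rw [show ((i : ℕ) : ℤ) + P * k + 1 = (((⟨0, hP⟩ : Fin P) : ℕ) : ℤ) + P * (k + 1) by
      push_cast; rw [← h3]; ring, this, xext_add]
    have h4 := (hX.2 ⟨0, hP⟩).1
    have h5 := (hX.2 i).2
    linarith

lemma xext_mono (L : ℕ) {P : ℕ} (hP : 0 < P) (X : Fin P → ℤ) (hX : IsConfig L P X) (N : ℤ) :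
    Monotone fun m => xext L hP X (m + N) - m := by
  apply monotone_int_of_le_succ
  intro m
  have := xext_succ L hP X hX (m + N)
  rw [show m + 1 + N = m + N + 1 by ring]
  linarith

lemma comb_main {L P : ℕ} (hP : 0 < P) (X Y : Fin P → ℤ)
    (hX : IsConfig L P X) (hY : IsConfig L P Y) (σ : Equiv.Perm (Fin P)) (n : Fin P → ℤ)
    (H1 : ∀ i : Fin P, 0 ≤ ((i : ℕ) : ℤ) - ((σ i : ℕ) : ℤ) + P * n i - ∑ k, n k →
      X i - Y (σ i) + n i * L ≤ ((i : ℕ) : ℤ) - ((σ i : ℕ) : ℤ) + P * n i - ∑ k, n k)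
    (H2 : ∀ i : Fin P, ((i : ℕ) : ℤ) - ((σ i : ℕ) : ℤ) + P * n i - ∑ k, n k ≤ 0 →
      ((i : ℕ) : ℤ) - ((σ i : ℕ) : ℤ) + P * n i - ∑ k, n k ≤ X i - Y (σ i) + n i * L) :
    X = Y ∧ ∀ i, X i + n i * L - ((i : ℕ) + P * n i) = X (σ i) - (σ i : ℕ) := by
  have hP' : (0 : ℤ) < P := by exact_mod_cast hP
  set N := ∑ k, n k with hN
  have hU := xext_mono L hP X hX N
  have hW := xext_mono L hP Y hY 0
  have hfin : Function.Injective fun i : Fin P => ((i : ℕ) : ℤ) % (P : ℤ) := by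
    intro i j h
    have hi : ((i : ℕ) : ℤ) < P := by exact_mod_cast i.2
    have hj : ((j : ℕ) : ℤ) < P := by exact_mod_cast j.2
    simp only [Int.emod_eq_of_lt (Int.natCast_nonneg _) hi,
      Int.emod_eq_of_lt (Int.natCast_nonneg _) hj] at h
    exact Fin.ext (by exact_mod_cast h)
  have hUc : ∀ i : Fin P, xext L hP X (((i : ℕ) + P * n i - N) + N) = X i + n i * L := by
    intro i
    rw [sub_add_cancel, xext_add]
  have hWd : ∀ i : Fin P, xext L hP Y ((i : ℕ) + 0) = Y i := by
    intro i
    have := xext_add L hP Y i 0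
    simpa using this
  have key := key_comb hP (fun m => xext L hP X (m + N) - m) (fun m => xext L hP Y (m + 0) - m)
    (L - P) hU hW
    (by intro c; rw [show c + (P : ℤ) + N = c + N + P by ring, xext_per]; ring)
    (by intro c; rw [show c + (P : ℤ) + 0 = c + 0 + P by ring, xext_per]; ring)
    (fun i => (i : ℕ) + P * n i - N) (fun i => (σ i : ℕ))
    (by
      apply inj_shift
      simpa using hfin)
    (fun i j h => σ.injective (hfin h))
    (by
      rw [Equiv.sum_comp σ (fun i => ((i : ℕ) : ℤ)), Finset.sum_sub_distrib,
        Finset.sum_add_distrib, ← Finset.mul_sum, ← hN]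
      simp)
    (by
      intro i h
      have := H1 i (by linarith)
      simp only [hUc, hWd]
      linarith)
    (by
      intro i h
      have := H2 i (by linarith)
      simp only [hUc, hWd]
      linarith)
  have key2 : ∀ j : Fin P, xext L hP X ((j : ℕ) + N) = Y j := by
    intro j
    have := key (σ.symm j)
    simp only [Equiv.apply_symm_apply, hWd] at this
    linarith
  have hdiv : ∀ j : Fin P, 0 ≤ ((j : ℕ) : ℤ) + N ∧ ((j : ℕ) : ℤ) + N < P := by
    intro j
    obtain ⟨i, k, hik⟩ := exists_rep hP (((j : ℕ) : ℤ) + N)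
    have h := key2 j
    rw [hik, xext_add] at h
    have hi : ((i : ℕ) : ℤ) < P := by exact_mod_cast i.2
    obtain ⟨a1, a2⟩ := hX.2 i
    obtain ⟨a3, a4⟩ := hY.2 j
    have hk : k = 0 := by
      rcases lt_trichotomy k 0 with hk | hk | hk
      · nlinarith
      · exact hk
      · nlinarith
    subst hk
    rw [hik]
    constructor <;> simp [hi]
  have hN0 : N = 0 := by
    have h1 := (hdiv ⟨0, hP⟩).1
    have h2 := (hdiv ⟨P - 1, by omega⟩).2
    simp only at h1 h2
    omega
  have hXx : ∀ i : Fin P, xext L hP X (i : ℕ) = X i := by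
    intro i
    simpa using xext_add L hP X i 0
  have hXY : X = Y := by
    funext j
    have := key2 j
    rw [hN0, add_zero, hXx] at this
    exact this
  refine ⟨hXY, ?_⟩
  intro i
  rw [hN0] at H1 H2
  rw [hN0] at hU
  subst hXY
  rcases le_total 0 (((i : ℕ) : ℤ) - ((σ i : ℕ) : ℤ) + P * n i - 0) with h | h
  · have h1 := H1 i h
    have h2 := hU (show ((σ i : ℕ) : ℤ) ≤ (i : ℕ) + P * n i by linarith)
    simp only [add_zero, hXx, xext_add] at h2
    linarith
  · have h1 := H2 i h
    have h2 := hU (show ((i : ℕ) : ℤ) + P * n i ≤ ((σ i : ℕ) : ℤ) by linarith)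
    simp only [add_zero, hXx, xext_add] at h2
    linarith

lemma circle_inv {r : ℝ} (hr : 0 < r) (F : ℂ → ℂ) :
    (∮ z in C(0, r), F z) = ∮ w in C(0, r⁻¹), F w⁻¹ * (w ^ 2)⁻¹ := by
  have hinv : ∀ θ : ℝ, (circleMap 0 r⁻¹ θ)⁻¹ = circleMap 0 r (-θ) := by
    intro θ
    simp only [circleMap_zero]
    rw [mul_inv, ← Complex.exp_neg]
    push_cast
    rw [inv_inv, neg_mul]
  simp only [circleIntegral, deriv_circleMap, smul_eq_mul]
  have h1 : ∀ θ : ℝ, circleMap 0 r⁻¹ θ * Complex.I *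
      (F (circleMap 0 r⁻¹ θ)⁻¹ * (circleMap 0 r⁻¹ θ ^ 2)⁻¹) =
      (fun θ => circleMap 0 r θ * Complex.I * F (circleMap 0 r θ)) (-θ) := by
    intro θ
    have hne : circleMap 0 r⁻¹ θ ≠ 0 := circleMap_ne_center (inv_ne_zero hr.ne')
    simp only [← hinv θ]
    field_simp
  simp_rw [h1]
  rw [intervalIntegral.integral_comp_neg (fun θ => circleMap 0 r θ * Complex.I * F (circleMap 0 r θ))]
  have hper : Function.Periodic (fun θ => circleMap 0 r θ * Complex.I * F (circleMap 0 r θ))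
      (2 * Real.pi) := by
    intro θ
    simp only [periodic_circleMap 0 r θ]
  have := hper.intervalIntegral_add_eq (-(2 * Real.pi)) 0
  simp at this
  rw [neg_zero, ← this]

lemma two_pi_ne : (2 * (Real.pi : ℂ) * Complex.I) ≠ 0 := by
  simp [Real.pi_ne_zero]

lemma cauchy0 {R : ℝ} (hR : 0 < R) (G : ℂ → ℂ) (hG : DifferentiableOn ℂ G (Metric.closedBall 0 R)) :
    (2 * (Real.pi : ℂ) * Complex.I)⁻¹ * (∮ z in C(0, R), z⁻¹ * G z) = G 0 := by
  have := hG.circleIntegral_sub_inv_smul (w := 0) (by simpa using hR)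
  simp only [sub_zero, smul_eq_mul] at this
  rw [this, inv_mul_cancel_left₀ two_pi_ne]

/-- `f(a, a + k)` for `a = m ≥ 0`, `k ≥ 0`. -/
lemma fInt_pos {lam r : ℝ} (hr1 : 1 < r) (m k : ℕ) :
    fInt lam r m (m + k) 0 = (lam : ℂ) ^ m * 0 ^ k := by
  have hr0 : 0 < r := by linarith
  unfold fInt
  rw [circle_inv hr0]
  have hR : 0 < r⁻¹ := inv_pos.mpr hr0
  have hR1 : r⁻¹ < 1 := inv_lt_one_of_one_lt₀ hr1
  have hne : ∀ w : ℂ, w ∈ Metric.closedBall (0 : ℂ) r⁻¹ → 1 - w ≠ 0 := by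
    intro w hw h
    have : w = 1 := by linear_combination -h
    rw [this] at hw
    simp at hw
    rw [inv_eq_one_div, le_div_iff₀ hr0] at hw
    linarith
  rw [circleIntegral.integral_congr (g := fun w => w⁻¹ * ((w + lam) ^ m * ((1 - w) ^ m)⁻¹ * w ^ k))
    hR.le, cauchy0 hR (fun w => (w + lam) ^ m * ((1 - w) ^ m)⁻¹ * w ^ k)]
  · simp
  · apply DifferentiableOn.mul
    · apply DifferentiableOn.mul
      · fun_prop
      · apply DifferentiableOn.inv
        · fun_prop
        · intro w hw
          exact pow_ne_zero _ (hne w hw)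
    · fun_prop
  · intro w hw
    have hw0 : w ≠ 0 := by
      rintro rfl
      simp at hw
      exact hr0.ne hw
    have h1 := hne w (Metric.sphere_subset_closedBall hw)
    have e1 : (1 + (lam : ℂ) * w⁻¹) = (w + lam) * w⁻¹ := by field_simp
    have e2 : (w⁻¹ - 1) = (1 - w) * w⁻¹ := by field_simp
    have e3 : (w⁻¹) ^ ((m : ℤ) - (m + k) - 1) = w ^ (k + 1) := by
      rw [inv_zpow, ← zpow_neg, ← zpow_natCast]
      congr 1
      push_cast; ring
    simp only [e1, e2, e3]
    rw [Nat.cast_zero, zero_add, zpow_natCast, zpow_neg, zpow_natCast, mul_pow, mul_pow]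
    field_simp
    ring

/-- `f(-m, -m - k)` for `k ≥ 0`. -/
lemma fInt_neg {lam r : ℝ} (hl : 0 < lam) (hr1 : 1 < r) (hr2 : r * lam < 1) (m k : ℕ) :
    fInt lam r (-m) (-m - k) 0 = (-1) ^ m * 0 ^ k := by
  have hr0 : 0 < r := by linarith
  unfold fInt
  have hne : ∀ w : ℂ, w ∈ Metric.closedBall (0 : ℂ) r → 1 + lam * w ≠ 0 := by
    intro w hw h
    have h2 : (lam : ℂ) * w = -1 := by linear_combination h
    have h3 := congrArg norm h2
    rw [norm_mul] at h3
    simp [abs_of_pos hl] at h3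
    simp at hw
    nlinarith
  rw [circleIntegral.integral_congr (g := fun w => w⁻¹ * ((w - 1) ^ m * ((1 + lam * w) ^ m)⁻¹ * w ^ k))
    hr0.le, cauchy0 hr0 (fun w => (w - 1) ^ m * ((1 + lam * w) ^ m)⁻¹ * w ^ k)]
  · simp
  · apply DifferentiableOn.mul
    · apply DifferentiableOn.mul
      · fun_prop
      · apply DifferentiableOn.inv
        · fun_prop
        · intro w hw
          exact pow_ne_zero _ (hne w hw)
    · fun_prop
  · intro w hw
    have hw0 : w ≠ 0 := by
      rintro rfl
      simp at hw
      exact hr0.ne hw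
    have h1 := hne w (Metric.sphere_subset_closedBall hw)
    have e3 : w ^ (-(m : ℤ) - (-m - k) - 1) = w ^ k * w⁻¹ := by
      rw [show (-(m : ℤ) - (-m - k) - 1) = (k : ℤ) + (-1) by ring, zpow_add₀ hw0, zpow_natCast,
        zpow_neg_one]
    simp only [e3]
    rw [Nat.cast_zero, zero_add, neg_neg, zpow_natCast, zpow_neg, zpow_natCast]
    ring

lemma fInt_zero1 {lam r : ℝ} (hr1 : 1 < r) {a b : ℤ} (ha : 0 ≤ a) (hb : a < b) :
    fInt lam r a b 0 = 0 := by
  obtain ⟨m, rfl⟩ := Int.eq_ofNat_of_zero_le ha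
  obtain ⟨k, hk⟩ := Int.eq_ofNat_of_zero_le (show 0 ≤ b - m by omega)
  obtain rfl : b = m + k := by omega
  rw [fInt_pos hr1, zero_pow (by omega), mul_zero]

lemma fInt_zero2 {lam r : ℝ} (hl : 0 < lam) (hr1 : 1 < r) (hr2 : r * lam < 1)
    {a b : ℤ} (ha : a ≤ 0) (hb : b < a) :
    fInt lam r a b 0 = 0 := by
  obtain ⟨m, hm⟩ := Int.eq_ofNat_of_zero_le (show 0 ≤ -a by omega)
  obtain ⟨k, hk⟩ := Int.eq_ofNat_of_zero_le (show 0 ≤ a - b by omega)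
  obtain rfl : a = - m := by omega
  obtain rfl : b = - m - k := by omega
  rw [fInt_neg hl hr1 hr2, zero_pow (by omega), mul_zero]

lemma fInt_diag1 {lam r : ℝ} (hr1 : 1 < r) (m : ℕ) : fInt lam r m m 0 = (lam : ℂ) ^ m := by
  simpa using fInt_pos (lam := lam) hr1 m 0

lemma fInt_diag2 {lam r : ℝ} (hl : 0 < lam) (hr1 : 1 < r) (hr2 : r * lam < 1) (m : ℕ) :
    fInt lam r (-m) (-m) 0 = (-1) ^ m := by
  simpa using fInt_neg (lam := lam) hl hr1 hr2 m 0

lemma diag_neg {lam r : ℝ} (hl : 0 < lam) (hr1 : 1 < r) (hr2 : r * lam < 1) {k : ℤ} (hk : k < 0) :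
    fInt lam r k k 0 + fInt lam r (k + 1) (k + 1) 0 = 0 := by
  obtain ⟨m, hm⟩ := Int.eq_ofNat_of_zero_le (show 0 ≤ -k - 1 by omega)
  rw [show k + 1 = -(m : ℤ) by omega, show k = -((m + 1 : ℕ) : ℤ) by push_cast; omega,
    fInt_diag2 hl hr1 hr2, fInt_diag2 hl hr1 hr2, pow_succ]
  ring

lemma det_tri {m : Type*} [Fintype m] [DecidableEq m] (M : Matrix m m ℂ) (b : m → ℤ)
    (hb : Function.Injective b) (h : ∀ i j, b i < b j → M i j = 0) :
    M.det = ∏ i, M i i := by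
  let _ : LinearOrder m := LinearOrder.lift' b hb
  have h2 : M.BlockTriangular OrderDual.toDual := by
    intro i j hij
    exact h i j hij
  convert Matrix.det_of_isLowerTriangular M h2

lemma det_clusters {m : Type*} [Fintype m] [DecidableEq m] (b κ : m → ℤ)
    (hb : Function.Injective b)
    (hmono : ∀ i j, b i < b j → κ i ≤ κ j)
    (hcont : ∀ i j, b i < b j → κ i = κ j → ∃ k, κ k = κ i ∧ b k = b i + 1)
    {lam r : ℝ} (hl : 0 < lam) (hr1 : 1 < r) (hr2 : r * lam < 1) :
    Matrix.det (Matrix.of fun i j : m => fInt lam r (b i - b j) (b i + κ i - (b j + κ j)) 0) =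
      ∏ i, if (∃ k, κ k = κ i ∧ b k = b i + 1) then (1 + lam : ℂ) else 1 := by
  classical
  set T : ℤ → ℂ := fun k => fInt lam r k k 0 with hT
  have hT0 : T 0 = 1 := by simpa using fInt_diag1 (lam := lam) hr1 0
  have hT1 : T 1 = lam := by simpa using fInt_diag1 (lam := lam) hr1 1
  set g : Matrix m m ℂ :=
    Matrix.of fun i j : m => fInt lam r (b i - b j) (b i + κ i - (b j + κ j)) 0 with hg
  have hgT : ∀ i j, κ i = κ j → g i j = T (b i - b j) := by
    intro i j h
    simp only [hg, hT, Matrix.of_apply, h]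
    congr 1
    ring
  have hg0 : ∀ i j, κ i ≠ κ j → g i j = 0 := by
    intro i j h
    simp only [hg, Matrix.of_apply]
    rcases lt_trichotomy (b i) (b j) with hij | hij | hij
    · have := hmono _ _ hij
      apply fInt_zero2 hl hr1 hr2 <;> omega
    · exact absurd (congrArg κ (hb hij)) h
    · have := hmono _ _ hij
      apply fInt_zero1 hr1 <;> omega
  let A : Matrix m m ℂ := Matrix.of fun i j =>
    if i = j then 1 else if κ j = κ i ∧ b j = b i + 1 then 1 else 0
  have hA : A.det = 1 := by
    rw [← Matrix.det_transpose, det_tri A.transpose b hb]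
    · simp [A]
    · intro i j hij
      have : j ≠ i := by rintro rfl; omega
      simp only [A, Matrix.transpose_apply, Matrix.of_apply, this, if_false]
      rw [if_neg]; omega
  have hAg1 : ∀ i k, κ k = κ i → b k = b i + 1 → ∀ j, (A * g) i j = g i j + g k j := by
    intro i k h1 h2 j
    have hik : i ≠ k := by rintro rfl; omega
    rw [Matrix.mul_apply, Finset.sum_eq_add_of_mem i k (Finset.mem_univ _) (Finset.mem_univ _) hik]
    · simp [A, hik, h1, h2]
    · intro l _ ⟨hl1, hl2⟩
      have : ¬ (κ l = κ i ∧ b l = b i + 1) := by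
        rintro ⟨_, h4⟩
        exact hl2 (hb (by omega))
      simp [A, this, Ne.symm hl1]
  have hAg2 : ∀ i, (¬ ∃ k, κ k = κ i ∧ b k = b i + 1) → ∀ j, (A * g) i j = g i j := by
    intro i h1 j
    rw [Matrix.mul_apply, Finset.sum_eq_single i]
    · simp [A]
    · intro l _ hl1
      have : ¬ (κ l = κ i ∧ b l = b i + 1) := fun h => h1 ⟨l, h⟩
      simp [A, this, Ne.symm hl1]
    · simp
  have : g.det = (A * g).det := by rw [Matrix.det_mul, hA, one_mul]
  rw [this, det_tri (A * g) b hb]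
  · apply Finset.prod_congr rfl
    intro i _
    split_ifs with h
    · obtain ⟨k, h1, h2⟩ := h
      rw [hAg1 i k h1 h2, hgT _ _ rfl, hgT _ _ h1, h2]
      simp [hT0, hT1]
    · rw [hAg2 i h, hgT _ _ rfl]
      simp [hT0]
  · intro i j hij
    by_cases hκ : κ i = κ j
    · obtain ⟨k, h1, h2⟩ := hcont i j hij hκ
      rw [hAg1 i k h1 h2, hgT _ _ hκ, hgT _ _ (h1.trans hκ), h2,
        show b i + 1 - b j = b i - b j + 1 by ring]
      exact diag_neg hl hr1 hr2 (by omega)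
    · by_cases h : ∃ k, κ k = κ i ∧ b k = b i + 1
      · obtain ⟨k, h1, h2⟩ := h
        rw [hAg1 i k h1 h2, hg0 _ _ hκ, hg0 _ _ (by rwa [h1]), add_zero]
      · rw [hAg2 i h, hg0 _ _ hκ]

lemma config_u {L P : ℕ} {X : Fin P → ℤ} (hX : IsConfig L P X) {i j : Fin P} (h : (i : ℕ) ≤ j) :
    X i - (i : ℕ) ≤ X j - (j : ℕ) := by
  have hP : 0 < P := by have := i.2; omega
  have := xext_mono L hP X hX 0 (show ((i : ℕ) : ℤ) ≤ (j : ℕ) by exact_mod_cast h)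
  have hXx : ∀ i : Fin P, xext L hP X (i : ℕ) = X i := by
    intro i
    simpa using xext_add L hP X i 0
  simpa [hXx] using this

lemma config_lo {L P : ℕ} {X : Fin P → ℤ} (hX : IsConfig L P X) (i : Fin P) :
    1 ≤ X i - (i : ℕ) := by
  have hP : 0 < P := by have := i.2; omega
  have h1 := config_u hX (i := ⟨0, hP⟩) (j := i) (by simp)
  have h2 := (hX.2 ⟨0, hP⟩).1
  simp at h1
  linarith

lemma config_hi {L P : ℕ} {X : Fin P → ℤ} (hX : IsConfig L P X) (i : Fin P) :
    X i - (i : ℕ) ≤ L - P + 1 := by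
  have hP : 0 < P := by have := i.2; omega
  have h1 := config_u hX (i := i) (j := ⟨P - 1, by omega⟩) (by simp; omega)
  have h2 := (hX.2 ⟨P - 1, by omega⟩).2
  simp only at h1
  omega

def eFun {P : ℕ} (X : Fin P → ℤ) (i : Fin P) : ℤ := if X i = (i : ℕ) + 1 then 1 else 0

lemma eFun_cases {P : ℕ} (X : Fin P → ℤ) (i : Fin P) :
    (eFun X i = 1 ∧ X i = (i : ℕ) + 1) ∨ (eFun X i = 0 ∧ X i ≠ (i : ℕ) + 1) := by
  unfold eFun
  split_ifs with h
  · exact Or.inl ⟨rfl, h⟩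
  · exact Or.inr ⟨rfl, h⟩

lemma succ_iff {L P : ℕ} (hPL : P < L) {X : Fin P → ℤ} (hX : IsConfig L P X) (i : Fin P) :
    (∃ k : Fin P, X k + eFun X k * (L - P) - (k : ℕ) = X i + eFun X i * (L - P) - (i : ℕ) ∧
      ((k : ℕ) : ℤ) + P * eFun X k = (i : ℕ) + P * eFun X i + 1) ↔
    ∃ j, X j = if X i = (L : ℤ) then 1 else X i + 1 := by
  have hi1 := config_lo hX i
  have hi2 := config_hi hX i
  have hi3 := i.2
  constructor
  · rintro ⟨k, h1, h2⟩
    refine ⟨k, ?_⟩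
    have hk1 := config_lo hX k
    have hk2 := config_hi hX k
    have hk3 := k.2
    have hk4 := (hX.2 k).2
    rcases eFun_cases X i with ⟨e1, e2⟩ | ⟨e1, e2⟩ <;> rcases eFun_cases X k with ⟨e3, e4⟩ | ⟨e3, e4⟩ <;>
      rw [e1, e3] at h1 h2 <;> split_ifs <;> omega
  · rintro ⟨k, h⟩
    refine ⟨k, ?_⟩
    have hk1 := config_lo hX k
    have hk2 := config_hi hX k
    have hk3 := k.2
    split_ifs at h with hL
    · have a1 : eFun X k = 1 := by unfold eFun; rw [if_pos]; omega
      have a2 : eFun X i = 0 := by unfold eFun; rw [if_neg]; omega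
      rw [a1, a2]
      constructor <;> omega
    · have hlt : i < k := by rw [← hX.1.lt_iff_lt]; omega
      rw [Fin.lt_def] at hlt
      have := config_u hX hlt.le
      have hk : (k : ℕ) = i + 1 := by omega
      have : eFun X k = eFun X i := by
        unfold eFun
        congr 1
        rw [hk, h]
        push_cast
        simp
      rw [this, hk]
      constructor
      · rw [h]; push_cast; ring
      · push_cast; ring

lemma det_config {L P : ℕ} (hPL : P < L) {X : Fin P → ℤ} (hX : IsConfig L P X)
    {lam r : ℝ} (hl : 0 < lam) (hr1 : 1 < r) (hr2 : r * lam < 1) :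
    Matrix.det (Matrix.of fun i j : Fin P =>
      fInt lam r (((i : ℕ) : ℤ) - ((j : ℕ) : ℤ) + P * (eFun X i - eFun X j))
        (X i - X j + (eFun X i - eFun X j) * L) 0) = (1 + lam : ℂ) ^ (P - Nc L X : ℕ) := by
  have key := det_clusters (fun i : Fin P => ((i : ℕ) : ℤ) + P * eFun X i)
    (fun i => X i + eFun X i * (L - P) - (i : ℕ))
    (by
      intro i j h
      have := i.2
      have := j.2
      apply Fin.ext
      beta_reduce at h
      rcases eFun_cases X i with ⟨e1, e2⟩ | ⟨e1, e2⟩ <;>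
        rcases eFun_cases X j with ⟨e3, e4⟩ | ⟨e3, e4⟩ <;> rw [e1, e3] at h <;> omega)
    (by
      intro i j h
      have := i.2
      have := j.2
      have := config_hi hX i
      have hu := @config_u L P X hX i j
      rcases eFun_cases X i with ⟨e1, e2⟩ | ⟨e1, e2⟩ <;>
        rcases eFun_cases X j with ⟨e3, e4⟩ | ⟨e3, e4⟩ <;> rw [e1, e3] at h ⊢ <;> omega)
    (by
      intro i j h h'
      have hi3 := i.2
      have hj3 := j.2
      have hi1 := config_lo hX i
      have hi2 := config_hi hX i
      have hj1 := config_lo hX j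
      have hj2 := config_hi hX j
      rw [succ_iff hPL hX i]
      by_cases hL : X i = L
      · rw [if_pos hL]
        refine ⟨⟨0, by omega⟩, ?_⟩
        have h1 := config_u hX (i := ⟨0, by omega⟩) (j := j) (by simp)
        have h2 := (hX.2 ⟨0, by omega⟩).1
        simp only at h1
        rcases eFun_cases X i with ⟨e1, e2⟩ | ⟨e1, e2⟩ <;>
          rcases eFun_cases X j with ⟨e3, e4⟩ | ⟨e3, e4⟩ <;> rw [e1, e3] at h h' <;> omega
      · rw [if_neg hL]
        have hi4 := (hX.2 i).2
        have hip : (i : ℕ) + 1 < P := by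
          rcases eFun_cases X i with ⟨e1, e2⟩ | ⟨e1, e2⟩ <;>
          rcases eFun_cases X j with ⟨e3, e4⟩ | ⟨e3, e4⟩ <;> rw [e1, e3] at h h' <;> omega
        refine ⟨⟨i + 1, hip⟩, ?_⟩
        have h1 := config_u hX (i := i) (j := ⟨i + 1, hip⟩) (by simp)
        have h3 := config_hi hX ⟨i + 1, hip⟩
        have h2 := config_u hX (i := ⟨i + 1, hip⟩) (j := j)
        simp only at h1 h2 h3
        push_cast at h1 h2 h3
        rcases eFun_cases X i with ⟨e1, e2⟩ | ⟨e1, e2⟩ <;>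
          rcases eFun_cases X j with ⟨e3, e4⟩ | ⟨e3, e4⟩ <;> rw [e1, e3] at h h' <;> omega)
    hl hr1 hr2
  simp only [succ_iff hPL hX] at key
  have e : (Matrix.of fun i j : Fin P =>
      fInt lam r (((i : ℕ) : ℤ) - ((j : ℕ) : ℤ) + P * (eFun X i - eFun X j))
        (X i - X j + (eFun X i - eFun X j) * L) 0) = Matrix.of fun i j : Fin P =>
      fInt lam r (((i : ℕ) : ℤ) + P * eFun X i - (((j : ℕ) : ℤ) + P * eFun X j))
        (((i : ℕ) : ℤ) + P * eFun X i + (X i + eFun X i * (L - P) - (i : ℕ)) -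
        (((j : ℕ) : ℤ) + P * eFun X j + (X j + eFun X j * (L - P) - (j : ℕ)))) 0 := by
    ext i j
    simp only [Matrix.of_apply]
    congr 1 <;> ring
  rw [e, key, Finset.prod_ite]
  simp only [Finset.prod_const_one, mul_one, Finset.prod_const]
  congr 1
  have hc := Finset.card_filter_add_card_filter_not (s := (Finset.univ : Finset (Fin P)))
    (fun i : Fin P => ∃ j, X j = if X i = (L : ℤ) then 1 else X i + 1)
  rw [Finset.card_univ, Fintype.card_fin] at hc
  simp only [not_exists] at hc
  have hN : Nc L X = (Finset.univ.filter fun i : Fin P =>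
      ∀ j : Fin P, ¬ X j = if X i = (L : ℤ) then 1 else X i + 1).card := by
    unfold Nc
    congr
  rw [hN]
  convert (Nat.eq_sub_of_add_eq hc) using 2

lemma term_ne {L P : ℕ} (hP : 0 < P) (X Y : Fin P → ℤ)
    (hX : IsConfig L P X) (hY : IsConfig L P Y)
    {lam r : ℝ} (hl : 0 < lam) (hr1 : 1 < r) (hr2 : r * lam < 1)
    (σ : Equiv.Perm (Fin P)) (n : Fin P → ℤ)
    (h : ∏ i : Fin P, fInt lam r (((i : ℕ) : ℤ) - ((σ i : ℕ) : ℤ) + (P : ℤ) * n i - ∑ k, n k)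
          (X i - Y (σ i) + n i * L) 0 ≠ 0) :
    X = Y ∧ ∀ i, X i + n i * L - ((i : ℕ) + P * n i) = X (σ i) - (σ i : ℕ) := by
  rw [Finset.prod_ne_zero_iff] at h
  apply comb_main hP X Y hX hY σ n
  · intro i hi
    by_contra! hlt
    exact h i (Finset.mem_univ _) (fInt_zero1 hr1 hi hlt)
  · intro i hi
    by_contra! hlt
    exact h i (Finset.mem_univ _) (fInt_zero2 hl hr1 hr2 hi hlt)

lemma n_eq {L P : ℕ} (hPL : P < L) {X : Fin P → ℤ} (hX : IsConfig L P X)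
    (σ : Equiv.Perm (Fin P)) (n : Fin P → ℤ)
    (h : ∀ i, X i + n i * L - ((i : ℕ) + P * n i) = X (σ i) - (σ i : ℕ)) :
    n = fun i => eFun X i - eFun X (σ i) := by
  funext i
  have h1 := h i
  have hi1 := config_lo hX i
  have hi2 := config_hi hX i
  have hj1 := config_lo hX (σ i)
  have hj2 := config_hi hX (σ i)
  have hD : (0 : ℤ) < (L : ℤ) - P := by omega
  have h2 : n i * ((L : ℤ) - P) = (X (σ i) - (σ i : ℕ)) - (X i - (i : ℕ)) := by linarith
  have h3 : n i ≤ 1 := by nlinarith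
  have h4 : -1 ≤ n i := by nlinarith
  have h5 : n i = -1 ∨ n i = 0 ∨ n i = 1 := by omega
  rcases eFun_cases X i with ⟨e1, e2⟩ | ⟨e1, e2⟩ <;>
    rcases eFun_cases X (σ i) with ⟨e3, e4⟩ | ⟨e3, e4⟩ <;>
    rcases h5 with h5 | h5 | h5 <;> rw [h5] at h2 <;> simp only [e1, e3, h5] <;> omega

lemma FL_expand {L P : ℕ} (lam r : ℝ) (X Y : Fin P → ℤ) (n : Fin P → ℤ) :
    Matrix.det (Matrix.of fun i j : Fin P =>
        fInt lam r (((i : ℕ) : ℤ) - ((j : ℕ) : ℤ) + (P : ℤ) * n i - ∑ k, n k)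
          (X i - Y j + n i * L) 0) =
    ∑ σ : Equiv.Perm (Fin P), ((Equiv.Perm.sign σ : ℤ) : ℂ) *
      ∏ i : Fin P, fInt lam r (((i : ℕ) : ℤ) - ((σ i : ℕ) : ℤ) + (P : ℤ) * n i - ∑ k, n k)
          (X i - Y (σ i) + n i * L) 0 := by
  rw [← Matrix.det_transpose, Matrix.det_apply']
  simp only [Matrix.transpose_apply, Matrix.of_apply]

lemma FL_eq {L P : ℕ} (hP : 0 < P) (hPL : P < L) (X : Fin P → ℤ)
    (hX : IsConfig L P X)
    {lam r : ℝ} (hl : 0 < lam) (hr1 : 1 < r) (hr2 : r * lam < 1) :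
    FL lam r L X X 0 = (1 + lam : ℂ) ^ (P - Nc L X : ℕ) := by
  rw [← det_config hPL hX hl hr1 hr2]
  unfold FL
  simp_rw [FL_expand]
  have hms : ∀ (c : ℂ) (h : Equiv.Perm (Fin P) → ℂ), c * ∑ σ, h σ = ∑ σ, c * h σ :=
    fun c h => Finset.mul_sum _ _ _
  simp_rw [hms]
  have hz : ∀ σ : Equiv.Perm (Fin P), ∀ n : Fin P → ℤ, n ≠ (fun i => eFun X i - eFun X (σ i)) →
      (-1 : ℂ) ^ (((P : ℤ) - 1) * ∑ i, n i) * (((Equiv.Perm.sign σ : ℤ) : ℂ) *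
      ∏ i : Fin P, fInt lam r (((i : ℕ) : ℤ) - ((σ i : ℕ) : ℤ) + (P : ℤ) * n i - ∑ k, n k)
          (X i - X (σ i) + n i * L) 0) = 0 := by
    intro σ n hn
    by_contra hne
    have := right_ne_zero_of_mul (right_ne_zero_of_mul hne)
    exact hn (n_eq hPL hX σ n (term_ne hP X X hX hX hl hr1 hr2 σ n this).2)
  rw [Summable.tsum_finsetSum]
  · rw [← Matrix.det_transpose, Matrix.det_apply']
    apply Finset.sum_congr rfl
    intro σ _
    rw [tsum_eq_single _ (hz σ)]
    have h0 : ∑ i, (eFun X i - eFun X (σ i)) = 0 := by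
      rw [Finset.sum_sub_distrib, Equiv.sum_comp σ (eFun X), sub_self]
    simp only [h0, Matrix.transpose_apply, Matrix.of_apply, mul_zero, zpow_zero, one_mul, sub_zero]
  · intro σ _
    apply summable_of_ne_finset_zero (s := {fun i => eFun X i - eFun X (σ i)})
    intro n hn
    exact hz σ n (by simpa using hn)


/-- resolution of the identity in the configurational basis:
`F_L(X,Y,0) = (1-v)^{N_c(X)-P}` if `X = Y` and `0` otherwise. -/
theorem stmt2 (L P : ℕ) (hP : 1 ≤ P) (hPL : P < L)
    (v : ℝ) (hv0 : 0 < v) (hv1 : v < 1 / 2)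
    (r : ℝ) (hr1 : 1 < r) (hr2 : r < 1 / (v / (1 - v)))
    (X Y : Fin P → ℤ) (hX : IsConfig L P X) (hY : IsConfig L P Y) :
    FL (v / (1 - v)) r L X Y 0 =
      if X = Y then ((1 - v : ℝ) : ℂ) ^ ((Nc L X : ℤ) - P) else 0 := by
  have hl : 0 < v / (1 - v) := div_pos hv0 (by linarith)
  have hr2' : r * (v / (1 - v)) < 1 := by rwa [lt_div_iff₀ hl] at hr2
  split_ifs with hXY
  · subst hXY
    rw [FL_eq hP hPL X hX hl hr1 hr2']
    have hle : Nc L X ≤ P := by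
      unfold Nc
      exact (Finset.card_filter_le _ _).trans (by simp)
    have h1 : ((1 - v : ℝ) : ℂ) ≠ 0 := by
      exact_mod_cast (show (1 - v : ℝ) ≠ 0 by linarith)
    have h2 : (1 : ℂ) + ((v / (1 - v) : ℝ) : ℂ) = ((1 - v : ℝ) : ℂ)⁻¹ := by
      have h3 : (1 : ℝ) + v / (1 - v) = (1 - v)⁻¹ := by
        have : (1 - v : ℝ) ≠ 0 := by linarith
        field_simp
        ring
      exact_mod_cast congrArg (fun x : ℝ => (x : ℂ)) h3
    rw [h2, ← zpow_natCast, inv_zpow, ← zpow_neg]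
    congr 1
    rw [Nat.cast_sub hle]
    ring
  · unfold FL
    simp_rw [FL_expand]
    have : ∀ n : Fin P → ℤ, ∀ σ : Equiv.Perm (Fin P),
        ∏ i : Fin P, fInt (v / (1 - v)) r (((i : ℕ) : ℤ) - ((σ i : ℕ) : ℤ) + (P : ℤ) * n i - ∑ k, n k)
          (X i - Y (σ i) + n i * L) 0 = 0 := by
      intro n σ
      by_contra hne
      exact hXY (term_ne hP X Y hX hY hl hr1 hr2' σ n hne).1
    simp [this]
end

section
/- Let 1 ≤ P < L and 0 < v < 1/2. Let X, Y be configurations of P particles on the ring of L sites, let σ be a permutation of {1,…,P}, and let n_1,…,n_P ∈ ℤ. If the product ∏_{i=1}^P f( i − σ(i) + P n_i − (n_1+⋯+n_P), x_i − y_{σ(i)} + n_i L, 0 ) is nonzero, then n_i ∈ {−1, 0, 1} for every i and n_1 + ⋯ + n_P = 0. Moreover, if not all n_i are zero, then x_1 = 1, x_P = L, y_1 = 1 and y_P = L (i.e. both X and Y have a cluster containing the sites 1 and L). -/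
open Classical

theorem aux_diff (lam : ℝ) (a m : ℤ) (z : ℂ)
    (h1 : 1 + (lam : ℂ) * z ≠ 0 ∨ 0 ≤ a) (h2 : z - 1 ≠ 0 ∨ 0 ≤ -a) (h3 : z ≠ 0 ∨ 0 ≤ m) :
    DifferentiableAt ℂ
      (fun z : ℂ => (1 + (lam : ℂ) * z) ^ a * (z - 1) ^ (-a) * z ^ m) z := by
  refine DifferentiableAt.mul (DifferentiableAt.mul ?_ ?_) ?_
  · exact DifferentiableAt.zpow (by fun_prop) h1
  · exact DifferentiableAt.zpow (by fun_prop) h2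
  · exact DifferentiableAt.zpow (by fun_prop) h3

theorem aux_neg (lam r : ℝ) (h0 : 0 < lam) (hr1 : 1 < r) (hr2 : lam * r < 1)
    (a m : ℤ) (ha : a ≤ 0) (hm : 0 ≤ m) :
    (∮ z in C(0, r), (1 + (lam : ℂ) * z) ^ a * (z - 1) ^ (-a) * z ^ m) = 0 := by
  have key : ∀ z ∈ Metric.closedBall (0 : ℂ) r, DifferentiableAt ℂ
      (fun z : ℂ => (1 + (lam : ℂ) * z) ^ a * (z - 1) ^ (-a) * z ^ m) z := by
    intro z hz
    refine aux_diff lam a m z (Or.inl ?_) (Or.inr (by omega)) (Or.inr hm)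
    intro h
    have hz' : ‖z‖ ≤ r := by simpa using hz
    have h' : (lam : ℂ) * z = -1 := by linear_combination h
    have h2 : lam * ‖z‖ = 1 := by
      have := congrArg norm h'
      simpa [abs_of_pos h0] using this
    nlinarith
  apply Complex.circleIntegral_eq_zero_of_differentiable_on_off_countable (by linarith)
    Set.countable_empty
  · intro z hz
    exact (key z hz).continuousAt.continuousWithinAt
  · intro z hz
    exact key z (Metric.ball_subset_closedBall hz.1)

theorem aux_pos (lam r : ℝ) (h0 : 0 < lam) (h01 : lam < 1) (hr1 : 1 < r)
    (k : ℕ) (m : ℤ) (hm : m ≤ -2) :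
    (∮ z in C(0, r), (1 + (lam : ℂ) * z) ^ (k : ℤ) * (z - 1) ^ (-(k : ℤ)) * z ^ m) = 0 := by
  set F : ℂ → ℂ := fun z => (1 + (lam : ℂ) * z) ^ (k : ℤ) * (z - 1) ^ (-(k : ℤ)) * z ^ m with hF
  have key : ∀ z : ℂ, r ≤ ‖z‖ → DifferentiableAt ℂ F z := by
    intro z hz
    refine aux_diff lam k m z (Or.inr (by omega)) (Or.inl ?_) (Or.inl ?_)
    · intro h
      have : z = 1 := by linear_combination h
      rw [this] at hz; simp at hz; linarith
    · intro h
      rw [h] at hz; simp at hz; linarith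
  have hbound : ∀ R : ℝ, r ≤ R → 2 ≤ R →
      ‖∮ z in C(0, r), F z‖ ≤ (2 * Real.pi * 4 ^ k) / R := by
    intro R hR hR2
    have heq : (∮ z in C(0, R), F z) = ∮ z in C(0, r), F z := by
      apply Complex.circleIntegral_eq_of_differentiable_on_annulus_off_countable (by linarith) hR
        Set.countable_empty
      · intro z hz
        have : r ≤ ‖z‖ := by simpa using hz.2
        exact (key z this).continuousAt.continuousWithinAt
      · intro z hz
        have : r < ‖z‖ := by simpa using hz.1.2
        exact key z this.le
    rw [← heq]
    have hb : ∀ z ∈ Metric.sphere (0 : ℂ) R, ‖F z‖ ≤ 4 ^ k * (R ^ 2)⁻¹ := by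
      intro z hz
      have hz' : ‖z‖ = R := by simpa using hz
      have e1 : ‖1 + (lam : ℂ) * z‖ ≤ 2 * R := by
        calc ‖1 + (lam : ℂ) * z‖ ≤ ‖(1 : ℂ)‖ + ‖(lam : ℂ) * z‖ := norm_add_le _ _
          _ = 1 + lam * R := by simp [abs_of_pos h0, hz']
          _ ≤ 2 * R := by nlinarith
      have e2 : R / 2 ≤ ‖z - 1‖ := by
        have := norm_sub_norm_le z 1
        rw [hz', norm_one] at this
        linarith
      have e3 : ‖z ^ m‖ ≤ (R ^ 2)⁻¹ := by
        rw [norm_zpow, hz']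
        have : R ^ m ≤ R ^ (-2 : ℤ) := zpow_le_zpow_right₀ (by linarith) hm
        simpa [zpow_neg] using this
      have e4 : ‖(1 + (lam : ℂ) * z) ^ (k : ℤ) * (z - 1) ^ (-(k : ℤ))‖ ≤ 4 ^ k := by
        rw [zpow_neg, zpow_natCast, zpow_natCast, ← inv_pow, ← mul_pow, norm_pow]
        apply pow_le_pow_left₀ (norm_nonneg _)
        rw [norm_mul, norm_inv, ← div_eq_mul_inv, div_le_iff₀ (by linarith)]
        linarith
      rw [hF]
      try simp only
      rw [norm_mul]
      exact mul_le_mul e4 e3 (norm_nonneg _) (by positivity)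
    have := circleIntegral.norm_integral_le_of_norm_le_const (by linarith : (0:ℝ) ≤ R) hb
    refine this.trans (le_of_eq ?_)
    have : R ≠ 0 := by linarith
    field_simp
  by_contra hne
  have hpos : 0 < ‖∮ z in C(0, r), F z‖ := norm_pos_iff.mpr hne
  set ε := ‖∮ z in C(0, r), F z‖
  set C := 2 * Real.pi * 4 ^ k with hC
  have hCp : 0 < C := by positivity
  have hd : 0 < C / ε := by positivity
  have := hbound (r + 2 + C / ε) (by linarith) (by linarith)
  rw [le_div_iff₀ (by linarith)] at this
  have h2 : ε * (C / ε) = C := by field_simp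
  nlinarith

theorem aux_f (lam r : ℝ) (h0 : 0 < lam) (h01 : lam < 1) (hr1 : 1 < r) (hr2 : lam * r < 1)
    (a b : ℤ) (h : fInt lam r a b 0 ≠ 0) : (0 ≤ a → b ≤ a) ∧ (a ≤ 0 → a ≤ b) := by
  constructor
  · intro ha
    by_contra hb
    apply h
    obtain ⟨k, rfl⟩ := Int.eq_ofNat_of_zero_le ha
    unfold fInt
    have := aux_pos lam r h0 h01 hr1 k (k - b - 1) (by omega)
    simp only [Nat.cast_zero, zero_add]
    rw [this]; simp
  · intro ha
    by_contra hb
    apply h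
    unfold fInt
    have := aux_neg lam r h0 hr1 hr2 a (a - b - 1) ha (by omega)
    simp only [Nat.cast_zero, zero_add]
    rw [this]; simp

theorem aux_core (P : ℕ) (hP : 1 ≤ P) (p q : Equiv.Perm (Fin P)) (n e : Fin P → ℤ) (M : ℤ)
    (hM : 1 ≤ M) (he : ∀ i, -M ≤ e i)
    (h1 : ∀ i, 0 ≤ ((p i : ℕ) : ℤ) - ((q i : ℕ) : ℤ) + (P : ℤ) * n i - ∑ k, n k →
      e i + n i * M + ∑ k, n k ≤ 0) : ∑ k, n k ≤ 0 := by
  by_contra hN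
  push Not at hN
  set N := ∑ k, n k with hNdef
  have hsum : ∑ i, (((p i : ℕ) : ℤ) - ((q i : ℕ) : ℤ) + (P : ℤ) * n i - N) = 0 := by
    rw [Finset.sum_sub_distrib, Finset.sum_add_distrib, Finset.sum_sub_distrib, ← Finset.mul_sum,
      Equiv.sum_comp p (fun j : Fin P => ((j : ℕ) : ℤ)),
      Equiv.sum_comp q (fun j : Fin P => ((j : ℕ) : ℤ)), ← hNdef]
    simp
  obtain ⟨i, hi⟩ : ∃ i, 0 ≤ ((p i : ℕ) : ℤ) - ((q i : ℕ) : ℤ) + (P : ℤ) * n i - N := by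
    by_contra hcon
    push Not at hcon
    have : ∑ i, (((p i : ℕ) : ℤ) - ((q i : ℕ) : ℤ) + (P : ℤ) * n i - N) < 0 :=
      Finset.sum_neg (fun i _ => hcon i) ⟨⟨0, hP⟩, Finset.mem_univ _⟩
    omega
  have hA : ∀ i, 0 ≤ ((p i : ℕ) : ℤ) - ((q i : ℕ) : ℤ) + (P : ℤ) * n i - N → n i ≤ 0 := by
    intro i hi
    have := h1 i hi
    have := he i
    by_contra hc
    push Not at hc
    nlinarith
  have hNP : N ≤ P - 1 := by
    have h3 := hA i hi
    have := (p i).2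
    have : (P : ℤ) * n i ≤ 0 := mul_nonpos_of_nonneg_of_nonpos (by omega) h3
    omega
  have hle : ∀ j, n j ≤ if (P : ℤ) - N + 1 ≤ ((q j : ℕ) : ℤ) then 1 else 0 := by
    intro j
    by_cases hj : n j ≤ 0
    · split_ifs <;> omega
    push Not at hj
    have h4 : ((p j : ℕ) : ℤ) - ((q j : ℕ) : ℤ) + (P : ℤ) * n j - N < 0 := by
      by_contra hc
      have := hA j (by omega)
      omega
    have := (q j).2
    have h5 : n j ≤ 1 := by
      by_contra hc
      have : (P : ℤ) * 2 ≤ P * n j := mul_le_mul_of_nonneg_left (by omega) (by omega)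
      omega
    have h6 : n j = 1 := by omega
    rw [h6] at h4 ⊢
    rw [if_pos (by omega)]
  have hs : N ≤ ∑ j, (if (P : ℤ) - N + 1 ≤ ((q j : ℕ) : ℤ) then (1 : ℤ) else 0) :=
    Finset.sum_le_sum (fun j _ => hle j)
  rw [Equiv.sum_comp q (fun j : Fin P => if (P : ℤ) - N + 1 ≤ ((j : ℕ) : ℤ) then (1 : ℤ) else 0),
    Fin.sum_univ_eq_sum_range (fun j : ℕ => if (P : ℤ) - N + 1 ≤ (j : ℤ) then (1 : ℤ) else 0) P,
    ← Finset.sum_filter, Finset.sum_const, nsmul_eq_mul, mul_one] at hs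
  have hsub : (Finset.range P).filter (fun j : ℕ => (P : ℤ) - N + 1 ≤ (j : ℤ)) ⊆
      Finset.Ico ((P : ℤ) - N + 1).toNat P := by
    intro j hj
    simp only [Finset.mem_filter, Finset.mem_range, Finset.mem_Ico] at hj ⊢
    omega
  have := Finset.card_le_card hsub
  rw [Nat.card_Ico] at this
  omega

theorem aux_mono (P : ℕ) (X : Fin P → ℤ) (hX : StrictMono X) (i j : Fin P) (hij : i ≤ j) :
    X i - (i : ℕ) ≤ X j - (j : ℕ) := by
  obtain ⟨j, hj⟩ := j
  induction j with
  | zero =>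
    have : i = ⟨0, hj⟩ := le_antisymm hij (by simp [Fin.le_def])
    rw [this]
  | succ k ih =>
    rcases hij.eq_or_lt with h | h
    · rw [h]
    · have h1 := ih (by omega) (by rw [Fin.lt_def] at h; rw [Fin.le_def]; simp at h ⊢; omega)
      have h2 : X ⟨k, by omega⟩ < X ⟨k + 1, hj⟩ := hX (by simp [Fin.lt_def])
      simp at h1 ⊢
      omega


/-- if the product `∏ᵢ f(i-σ(i)+Pnᵢ-Σn, xᵢ-y_{σ(i)}+nᵢL, 0)` is nonzero then each
`nᵢ ∈ {-1,0,1}` and `Σnᵢ = 0`; moreover if not all `nᵢ` vanish then both `X` and `Y` have a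
cluster containing the sites `1` and `L`. -/
theorem stmt3 (L P : ℕ) (hP : 1 ≤ P) (hPL : P < L)
    (v : ℝ) (hv0 : 0 < v) (hv1 : v < 1 / 2)
    (r : ℝ) (hr1 : 1 < r) (hr2 : r < 1 / (v / (1 - v)))
    (X Y : Fin P → ℤ) (hX : IsConfig L P X) (hY : IsConfig L P Y)
    (σ : Equiv.Perm (Fin P)) (n : Fin P → ℤ)
    (hprod : (∏ i : Fin P, fInt (v / (1 - v)) r
        (((i : ℕ) : ℤ) - ((σ i : ℕ) : ℤ) + (P : ℤ) * n i - ∑ k, n k)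
        (X i - Y (σ i) + n i * L) 0) ≠ 0) :
    (∀ i, n i = -1 ∨ n i = 0 ∨ n i = 1) ∧ (∑ i, n i = 0) ∧
      (¬ (∀ i, n i = 0) →
        X ⟨0, hP⟩ = 1 ∧ X ⟨P - 1, by omega⟩ = L ∧ Y ⟨0, hP⟩ = 1 ∧ Y ⟨P - 1, by omega⟩ = L) := by
  have hv : 0 < 1 - v := by linarith
  have hl0 : 0 < v / (1 - v) := by positivity
  have hl1 : v / (1 - v) < 1 := by rw [div_lt_one hv]; linarith
  have hlr : v / (1 - v) * r < 1 := by
    rw [lt_div_iff₀ hl0] at hr2; linarith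
  have hf : ∀ i : Fin P, (0 ≤ ((i : ℕ) : ℤ) - ((σ i : ℕ) : ℤ) + (P : ℤ) * n i - ∑ k, n k →
        X i - Y (σ i) + n i * L ≤ ((i : ℕ) : ℤ) - ((σ i : ℕ) : ℤ) + (P : ℤ) * n i - ∑ k, n k) ∧
      (((i : ℕ) : ℤ) - ((σ i : ℕ) : ℤ) + (P : ℤ) * n i - ∑ k, n k ≤ 0 →
        ((i : ℕ) : ℤ) - ((σ i : ℕ) : ℤ) + (P : ℤ) * n i - ∑ k, n k ≤ X i - Y (σ i) + n i * L) :=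
    fun i =>
    aux_f _ r hl0 hl1 hr1 hlr _ _ (Finset.prod_ne_zero_iff.mp hprod i (Finset.mem_univ i))
  clear hprod
  obtain ⟨hXm, hXb⟩ := hX
  obtain ⟨hYm, hYb⟩ := hY
  have hX0 : ∀ i, X ⟨0, hP⟩ ≤ X i - (i : ℕ) := fun i => by
    simpa using aux_mono P X hXm ⟨0, hP⟩ i (by simp [Fin.le_def])
  have hY0 : ∀ i, Y ⟨0, hP⟩ ≤ Y i - (i : ℕ) := fun i => by
    simpa using aux_mono P Y hYm ⟨0, hP⟩ i (by simp [Fin.le_def])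
  have hX1 : ∀ i, X i - (i : ℕ) ≤ X ⟨P - 1, by omega⟩ - ((P - 1 : ℕ) : ℤ) := fun i =>
    aux_mono P X hXm i ⟨P - 1, by omega⟩ (by have := i.2; simp [Fin.le_def]; omega)
  have hY1 : ∀ i, Y i - (i : ℕ) ≤ Y ⟨P - 1, by omega⟩ - ((P - 1 : ℕ) : ℤ) := fun i =>
    aux_mono P Y hYm i ⟨P - 1, by omega⟩ (by have := i.2; simp [Fin.le_def]; omega)
  have bX0 := (hXb ⟨0, hP⟩).1
  have bY0 := (hYb ⟨0, hP⟩).1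
  have bX1 := (hXb ⟨P - 1, by omega⟩).2
  have bY1 := (hYb ⟨P - 1, by omega⟩).2
  have hN1 : ∑ k, n k ≤ 0 := by
    apply aux_core P hP (Equiv.refl _) σ n
      (fun i => (X i - (i : ℕ)) - (Y (σ i) - (σ i : ℕ))) (L - P) (by omega)
    · intro i
      have := hX0 i
      have := hY1 (σ i)
      try simp only
      omega
    · intro i hi
      have := (hf i).1 hi
      try simp only
      linarith
  have hN2 : ∑ k, (- n k) ≤ 0 := by
    apply aux_core P hP σ (Equiv.refl _) (fun k => - n k)
      (fun i => (Y (σ i) - (σ i : ℕ)) - (X i - (i : ℕ))) (L - P) (by omega)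
    · intro i
      have := hX1 i
      have := hY0 (σ i)
      try simp only
      omega
    · intro i hi
      rw [Finset.sum_neg_distrib] at hi ⊢
      simp only [Equiv.refl_apply] at hi
      have := (hf i).2 (by linarith)
      try simp only
      linarith
  rw [Finset.sum_neg_distrib] at hN2
  have hN : ∑ k, n k = 0 := by omega
  rw [hN] at hf
  have main : ∀ i, n i = 0 ∨
      (n i = 1 ∧ X i - (i : ℕ) = 1 ∧ Y (σ i) - (σ i : ℕ) = L - P + 1) ∨
      (n i = -1 ∧ Y (σ i) - (σ i : ℕ) = 1 ∧ X i - (i : ℕ) = L - P + 1) := by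
    intro i
    have a1 := hX0 i
    have a2 := hX1 i
    have a3 := hY0 (σ i)
    have a4 := hY1 (σ i)
    have a5 := i.2
    have a6 := (σ i).2
    obtain ⟨f1, f2⟩ := hf i
    have hLP : (1 : ℤ) ≤ L - P := by omega
    rcases lt_trichotomy (n i) 0 with h | h | h
    · right; right
      have g : (P : ℤ) * n i ≤ P * (-1) := mul_le_mul_of_nonneg_left (by omega) (by omega)
      have f3 := f2 (by omega)
      have : n i = -1 := by
        by_contra hc
        have : n i ≤ -2 := by omega
        have : ((P : ℤ) - L) * n i ≥ (L - P) * 2 := by nlinarith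
        have : ((P : ℤ) - L) * n i = P * n i - n i * L := by ring
        omega
      rw [this] at f3 ⊢
      omega
    · left; exact h
    · right; left
      have g : (P : ℤ) * 1 ≤ P * n i := mul_le_mul_of_nonneg_left (by omega) (by omega)
      have f3 := f1 (by omega)
      have : n i = 1 := by
        by_contra hc
        have : 2 ≤ n i := by omega
        have : ((L : ℤ) - P) * n i ≥ (L - P) * 2 := by nlinarith
        have : ((L : ℤ) - P) * n i = n i * L - P * n i := by ring
        omega
      rw [this] at f3 ⊢
      omega
  refine ⟨fun i => by have := main i; omega, hN, fun hne => ?_⟩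
  obtain ⟨i, hi⟩ : ∃ i, 0 < n i := by
    by_contra hc
    push Not at hc
    exact hne fun i => (Finset.sum_eq_zero_iff_of_nonpos (fun i _ => hc i)).mp hN i
      (Finset.mem_univ i)
  obtain ⟨j, hj⟩ : ∃ j, n j < 0 := by
    by_contra hc
    push Not at hc
    exact hne fun i => (Finset.sum_eq_zero_iff_of_nonneg (fun i _ => hc i)).mp hN i
      (Finset.mem_univ i)
  have mi := main i
  have mj := main j
  have := hX0 i
  have := hY1 (σ i)
  have := hX1 j
  have := hY0 (σ j)
  refine ⟨?_, ?_, ?_, ?_⟩ <;> omega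
end

section
/- Let 1 ≤ P < L, 0 < v < 1/2, and t ∈ ℕ. Let X, Y be configurations of P particles on the ring of L sites, let σ be a permutation of {1,…,P}, and let n_1,…,n_P ∈ ℤ with S = n_1+⋯+n_P. If the product ∏_{i=1}^P f( i − σ(i) + P n_i − S, x_i − y_{σ(i)} + n_i L, t ) is nonzero, then: 0 ≤ S ≤ t; L·S ≤ P·(L−P+t); and for every i, −(L−P) − S ≤ (L−P)·n_i ≤ (L−P) + t − S (in particular −(L−P) − t ≤ (L−P)·n_i ≤ (L−P) + t). -/
open Classical

theorem hermite (P : ℕ) (hP : 1 ≤ P) (x : ℤ) :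
    ∑ i : Fin P, (((i : ℕ) : ℤ) + x) / (P : ℤ) = x := by
  have hP0 : (P : ℤ) ≠ 0 := by omega
  rw [Fin.sum_univ_eq_sum_range (fun i : ℕ => ((i : ℤ) + x) / (P : ℤ))]
  have step : ∀ y : ℤ, ∑ i ∈ Finset.range P, (((i : ℕ) : ℤ) + (y + 1)) / (P : ℤ)
      = ∑ i ∈ Finset.range P, (((i : ℕ) : ℤ) + y) / (P : ℤ) + 1 := by
    intro y
    have h := Finset.sum_range_sub (fun i : ℕ => ((i : ℤ) + y) / (P : ℤ)) P
    rw [Finset.sum_sub_distrib] at h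
    have e : (((P : ℤ) + y) / (P : ℤ)) = y / P + 1 := by
      rw [add_comm, Int.add_ediv_of_dvd_right (dvd_refl _), Int.ediv_self hP0]
    simp only [e] at h
    have e2 : ∑ i ∈ Finset.range P, (((i : ℕ) : ℤ) + (y + 1)) / (P : ℤ)
        = ∑ i ∈ Finset.range P, (((i + 1 : ℕ) : ℤ) + y) / (P : ℤ) := by
      apply Finset.sum_congr rfl
      intro i _
      congr 1
      push_cast
      ring
    rw [e2]
    simp at h ⊢
    linarith
  induction x using Int.induction_on with
  | zero =>
    apply Finset.sum_eq_zero
    intro i hi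
    rw [add_zero]
    exact Int.ediv_eq_zero_of_lt (by omega) (by exact_mod_cast Finset.mem_range.mp hi)
  | succ k ih => rw [step, ih]
  | pred k ih =>
    have := step (-(k : ℤ) - 1)
    rw [sub_add_cancel, ih] at this
    linarith

theorem comb (P : ℕ) (hP : 1 ≤ P) (D : ℤ) (t : ℕ) (ξ η : ℤ → ℤ) (hξ : Monotone ξ) (hη : Monotone η)
    (pξ : ∀ k q : ℤ, ξ (k + P * q) = ξ k + D * q) (pη : ∀ k q : ℤ, η (k + P * q) = η k + D * q)
    (τ : Fin P → ℤ) (hτ : ∀ c : ℤ, ∑ i : Fin P, (τ i - c) / (P : ℤ) = -c)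
    (h1 : ∀ i : Fin P, τ i < ((i : ℕ) : ℤ) ∨ η (τ i) ≤ ξ ((i : ℕ) : ℤ))
    (h2 : ∀ i : Fin P, ((i : ℕ) : ℤ) + t < τ i ∨ ξ ((i : ℕ) : ℤ) - η (τ i) ≤ t) :
    (∀ i : Fin P, η (τ i) ≤ ξ ((i : ℕ) : ℤ) ∧ ξ ((i : ℕ) : ℤ) - η (τ i) ≤ t) ∧
    ∀ k : ℤ, η k ≤ ξ k ∧ ξ k - η k ≤ t := by
  have hPp : (0 : ℤ) < P := by omega
  have hid : ∀ c : ℤ, ∑ i : Fin P, (((i : ℕ) : ℤ) - c) / (P : ℤ) = -c := by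
    intro c
    simpa [sub_eq_add_neg] using hermite P hP (-c)
  have A : ∀ i : Fin P, η (τ i) ≤ ξ ((i : ℕ) : ℤ) := by
    intro i
    rcases h1 i with h | h
    swap
    · exact h
    by_contra hc
    push Not at hc
    have hex : ∃ m ∈ (Finset.univ : Finset (Fin P)), (((m : ℕ) : ℤ) - ((i : ℕ) : ℤ)) / (P : ℤ) < (τ m - ((i : ℕ) : ℤ)) / (P : ℤ) := by
      by_contra hn
      push Not at hn
      have hlt := Finset.sum_lt_sum hn ⟨i, Finset.mem_univ _, by
        rw [sub_self, Int.zero_ediv]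
        exact Int.ediv_neg_of_neg_of_pos (by omega) hPp⟩
      rw [hτ, hid] at hlt
      exact lt_irrefl _ hlt
    obtain ⟨m, -, hm⟩ := hex
    set q := (τ m - ((i : ℕ) : ℤ)) / (P : ℤ) with hq
    have g1 : ((m : ℕ) : ℤ) - ((i : ℕ) : ℤ) < q * P := (Int.ediv_lt_iff_lt_mul hPp).1 hm
    have g2 : q * P ≤ τ m - ((i : ℕ) : ℤ) := (Int.le_ediv_iff_mul_le hPp).1 le_rfl
    have k1 : ξ ((m : ℕ) : ℤ) ≤ ξ (((i : ℕ) : ℤ) + P * q) := hξ (by linarith)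
    have k2 : η (τ i + P * q) ≤ η (τ m) := hη (by linarith)
    rw [pξ] at k1
    rw [pη] at k2
    rcases h1 m with h' | h' <;> linarith
  have B : ∀ i : Fin P, ξ ((i : ℕ) : ℤ) - η (τ i) ≤ t := by
    intro i
    rcases h2 i with h | h
    swap
    · exact h
    by_contra hc
    push Not at hc
    have hex : ∃ m ∈ (Finset.univ : Finset (Fin P)), (τ m - τ i) / (P : ℤ) < (((m : ℕ) : ℤ) - τ i) / (P : ℤ) := by
      by_contra hn
      push Not at hn
      have hlt := Finset.sum_lt_sum hn ⟨i, Finset.mem_univ _, by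
        rw [sub_self, Int.zero_ediv]
        exact Int.ediv_neg_of_neg_of_pos (by omega) hPp⟩
      rw [hτ, hid] at hlt
      exact lt_irrefl _ hlt
    obtain ⟨m, -, hm⟩ := hex
    set q := (((m : ℕ) : ℤ) - τ i) / (P : ℤ) with hq
    have g1 : τ m - τ i < q * P := (Int.ediv_lt_iff_lt_mul hPp).1 hm
    have g2 : q * P ≤ ((m : ℕ) : ℤ) - τ i := (Int.le_ediv_iff_mul_le hPp).1 le_rfl
    have k1 : ξ (((i : ℕ) : ℤ) + P * q) ≤ ξ ((m : ℕ) : ℤ) := hξ (by linarith)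
    have k2 : η (τ m) ≤ η (τ i + P * q) := hη (by linarith)
    rw [pξ] at k1
    rw [pη] at k2
    rcases h2 m with h' | h' <;> linarith
  refine ⟨fun i => ⟨A i, B i⟩, fun k => ⟨?_, ?_⟩⟩
  · have hex : ∃ m ∈ (Finset.univ : Finset (Fin P)), (((m : ℕ) : ℤ) - (k + 1)) / (P : ℤ) < (τ m - k) / (P : ℤ) := by
      apply Finset.exists_lt_of_sum_lt
      rw [hτ, hid]
      linarith
    obtain ⟨m, -, hm⟩ := hex
    set q := (τ m - k) / (P : ℤ) with hq
    have g1 : ((m : ℕ) : ℤ) - (k + 1) < q * P := (Int.ediv_lt_iff_lt_mul hPp).1 hm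
    have g2 : q * P ≤ τ m - k := (Int.le_ediv_iff_mul_le hPp).1 le_rfl
    have k1 : ξ ((m : ℕ) : ℤ) ≤ ξ (k + P * q) := hξ (by linarith)
    have k2 : η (k + P * q) ≤ η (τ m) := hη (by linarith)
    rw [pξ] at k1
    rw [pη] at k2
    linarith [A m]
  · have hex : ∃ m ∈ (Finset.univ : Finset (Fin P)), (τ m - (k + 1)) / (P : ℤ) < (((m : ℕ) : ℤ) - k) / (P : ℤ) := by
      apply Finset.exists_lt_of_sum_lt
      rw [hτ, hid]
      linarith
    obtain ⟨m, -, hm⟩ := hex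
    set q := (((m : ℕ) : ℤ) - k) / (P : ℤ) with hq
    have g1 : τ m - (k + 1) < q * P := (Int.ediv_lt_iff_lt_mul hPp).1 hm
    have g2 : q * P ≤ ((m : ℕ) : ℤ) - k := (Int.le_ediv_iff_mul_le hPp).1 le_rfl
    have k1 : ξ (k + P * q) ≤ ξ ((m : ℕ) : ℤ) := hξ (by linarith)
    have k2 : η (τ m) ≤ η (k + P * q) := hη (by linarith)
    rw [pξ] at k1
    rw [pη] at k2
    linarith [B m]

/-- periodic extension of a configuration -/
theorem extend (L P : ℕ) (hP : 1 ≤ P) (X : Fin P → ℤ) (hX : IsConfig L P X) :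
    ∃ xe : ℤ → ℤ, (∀ i : Fin P, xe ((i : ℕ) : ℤ) = X i) ∧
      (∀ k q : ℤ, xe (k + P * q) = xe k + L * q) ∧ Monotone (fun k => xe k - k) ∧
      1 ≤ xe 0 ∧ xe (P - 1) ≤ L := by
  have hPp : (0 : ℤ) < P := by omega
  obtain ⟨hmono, hb⟩ := hX
  have hlt : ∀ k : ℤ, (k % (P : ℤ)).toNat < P := by
    intro k
    have h1 := Int.emod_nonneg k hPp.ne'
    have h2 := Int.emod_lt_of_pos k hPp
    omega
  let xe : ℤ → ℤ := fun k => X ⟨(k % (P : ℤ)).toNat, hlt k⟩ + L * (k / (P : ℤ))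
  have e1 : ∀ i : Fin P, xe ((i : ℕ) : ℤ) = X i := by
    intro i
    have hi : ((i : ℕ) : ℤ) < P := by exact_mod_cast i.2
    have a1 : ((i : ℕ) : ℤ) % (P : ℤ) = i := Int.emod_eq_of_lt (by omega) hi
    have a2 : ((i : ℕ) : ℤ) / (P : ℤ) = 0 := Int.ediv_eq_zero_of_lt (by omega) hi
    simp only [xe, a1, a2, Int.toNat_natCast]
    simp
  have e2 : ∀ k q : ℤ, xe (k + P * q) = xe k + L * q := by
    intro k q
    simp only [xe, Int.add_mul_emod_self_left, Int.add_mul_ediv_left _ _ hPp.ne']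
    ring
  refine ⟨xe, e1, e2, ?_, ?_, ?_⟩
  · apply monotone_int_of_le_succ
    intro k
    have hk := Int.emod_add_mul_ediv k P
    have n0 := Int.emod_nonneg k hPp.ne'
    have n1 := Int.emod_lt_of_pos k hPp
    obtain ⟨j, hj⟩ := Int.eq_ofNat_of_zero_le n0
    have hjP : j < P := by omega
    set q := k / (P : ℤ)
    have hk' : k = (j : ℤ) + P * q := by rw [← hj]; exact hk.symm
    have v1 : xe k = X ⟨j, hjP⟩ + L * q := by
      rw [hk', e2]
      rw [← e1 ⟨j, hjP⟩]
    by_cases hc : j + 1 < P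
    · have v2 : xe (k + 1) = X ⟨j + 1, hc⟩ + L * q := by
        rw [← e1 ⟨j + 1, hc⟩, ← e2, hk']
        congr 1
        push_cast
        ring
      have := hmono (show (⟨j, hjP⟩ : Fin P) < ⟨j + 1, hc⟩ from Fin.mk_lt_mk.2 (Nat.lt_succ_self j))
      rw [v1, v2]
      linarith
    · have v2 : xe (k + 1) = X ⟨0, hP⟩ + L * (q + 1) := by
        rw [← e1 ⟨0, hP⟩, ← e2, hk']
        congr 1
        have : (j : ℤ) + 1 = P := by omega
        push_cast
        linarith
      rw [v1, v2]
      have := hb ⟨0, hP⟩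
      have := hb ⟨j, hjP⟩
      linarith
  · have := e1 ⟨0, hP⟩
    simp only [Nat.cast_zero] at this
    rw [this]
    exact (hb _).1
  · have := e1 ⟨P - 1, by omega⟩
    rw [Nat.cast_sub hP] at this
    simp only [Nat.cast_one] at this
    rw [this]
    exact (hb _).2

theorem f_zero_in (lam r : ℝ) (h0 : 0 < lam) (hr1 : 1 < r) (hr2 : r < 1 / lam) (a b : ℤ) (t : ℕ)
    (ha : a ≤ 0) (hb : b < a) : fInt lam r a b t = 0 := by
  unfold fInt
  have : (∮ z in C(0, r), (1 + (lam : ℂ) * z) ^ ((t : ℤ) + a) * (z - 1) ^ (-a) * z ^ (a - b - 1)) = 0 := by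
    have hd : DifferentiableOn ℂ (fun z : ℂ => (1 + (lam : ℂ) * z) ^ ((t : ℤ) + a) * (z - 1) ^ (-a) * z ^ (a - b - 1))
        (Metric.closedBall 0 r) := by
      intro z hz
      apply DifferentiableAt.differentiableWithinAt
      have hz' : ‖z‖ ≤ r := by simpa using hz
      have hne : 1 + (lam : ℂ) * z ≠ 0 := by
        intro h
        have h2 : (lam : ℂ) * z = -1 := by linear_combination h
        have h3 := congrArg norm h2
        rw [norm_mul, norm_neg, norm_one, Complex.norm_real, Real.norm_of_nonneg h0.le] at h3
        have := (lt_div_iff₀ h0).1 hr2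
        nlinarith
      refine DifferentiableAt.mul (DifferentiableAt.mul ?_ ?_) ?_
      · exact DifferentiableAt.zpow (by fun_prop) (Or.inl hne)
      · exact DifferentiableAt.zpow (by fun_prop) (Or.inr (by omega))
      · exact DifferentiableAt.zpow (by fun_prop) (Or.inr (by omega))
    apply Complex.circleIntegral_eq_zero_of_differentiable_on_off_countable (by linarith) Set.countable_empty hd.continuousOn
    intro z hz
    exact (hd z (Metric.ball_subset_closedBall hz.1)).differentiableAt
      (Metric.closedBall_mem_nhds_of_mem hz.1)
  rw [this]
  simp

theorem f_zero_out (lam r : ℝ) (hr1 : 1 < r) (a b : ℤ) (t : ℕ)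
    (ha : 0 ≤ t + a) (hb : t + a < b) : fInt lam r a b t = 0 := by
  unfold fInt
  set F : ℂ → ℂ := fun z : ℂ => (1 + (lam : ℂ) * z) ^ ((t : ℤ) + a) * (z - 1) ^ (-a) * z ^ (a - b - 1) with hF
  have key : (∮ z in C(0, r), F z) = 0 := by
    have hd : ∀ z : ℂ, 1 < ‖z‖ → DifferentiableAt ℂ F z := by
      intro z hz
      refine DifferentiableAt.mul (DifferentiableAt.mul ?_ ?_) ?_
      · exact DifferentiableAt.zpow (by fun_prop) (Or.inr ha)
      · refine DifferentiableAt.zpow (by fun_prop) (Or.inl ?_)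
        intro h
        rw [sub_eq_zero.1 h] at hz
        simp at hz
      · refine DifferentiableAt.zpow (by fun_prop) (Or.inl ?_)
        intro h
        rw [h] at hz
        simp at hz
        linarith
    have heq : ∀ R : ℝ, r ≤ R → (∮ z in C(0, R), F z) = ∮ z in C(0, r), F z := by
      intro R hR
      apply Complex.circleIntegral_eq_of_differentiable_on_annulus_off_countable (by linarith) hR Set.countable_empty
      · intro z hz
        apply ContinuousAt.continuousWithinAt
        apply (hd z _).continuousAt
        have : r ≤ ‖z‖ := by simpa using hz.2
        linarith
      · intro z hz
        apply hd
        have : r < ‖z‖ := by simpa using hz.1.2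
        linarith
    have hbound : ∃ C : ℝ, ∀ z : ℂ, 2 ≤ ‖z‖ → ‖F z‖ ≤ C * (‖z‖ ^ 2)⁻¹ := by
      have hc : ContinuousOn (fun w : ℂ => (w + (lam : ℂ)) ^ ((t : ℤ) + a) * (1 - w) ^ (-a))
          (Metric.closedBall 0 (1 / 2)) := by
        intro w hw
        apply ContinuousAt.continuousWithinAt
        refine ContinuousAt.mul ?_ ?_
        · exact ContinuousAt.zpow₀ (by fun_prop) _ (Or.inr ha)
        · refine ContinuousAt.zpow₀ (by fun_prop) _ (Or.inl ?_)
          intro h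
          have : w = 1 := (sub_eq_zero.1 h).symm
          rw [this] at hw
          simp at hw
          norm_num at hw
      obtain ⟨C, hC⟩ := (isCompact_closedBall (0 : ℂ) (1 / 2)).exists_bound_of_continuousOn hc
      refine ⟨C, fun z hz => ?_⟩
      have hz0 : z ≠ 0 := by
        intro h
        rw [h] at hz
        simp at hz
        linarith
      have hw : ‖z⁻¹‖ ≤ 1 / 2 := by
        rw [norm_inv, one_div]
        exact inv_anti₀ (by norm_num) hz
      have hC' := hC z⁻¹ (by simpa using hw)
      have hC0 : 0 ≤ C := (norm_nonneg _).trans hC'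
      have e : F z = ((z⁻¹ + (lam : ℂ)) ^ ((t : ℤ) + a) * (1 - z⁻¹) ^ (-a)) * z ^ ((t : ℤ) + a - b - 1) := by
        have u1 : (1 + (lam : ℂ) * z) = (z⁻¹ + lam) * z := by field_simp
        have u2 : z - 1 = (1 - z⁻¹) * z := by field_simp
        have u3 : z ^ ((t : ℤ) + a - b - 1) = z ^ ((t : ℤ) + a) * z ^ (-a) * z ^ (a - b - 1) := by
          rw [← zpow_add₀ hz0, ← zpow_add₀ hz0]
          congr 1
          ring
        simp only [hF]
        rw [u3, u1, u2, mul_zpow, mul_zpow]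
        ring
      rw [e, norm_mul, norm_zpow]
      refine mul_le_mul hC' ?_ (by positivity) hC0
      rw [← zpow_natCast, ← zpow_neg]
      exact zpow_le_zpow_right₀ (by linarith) (by push_cast; omega)
    obtain ⟨C, hC⟩ := hbound
    have hle : ∀ R : ℝ, max r 2 ≤ R → ‖∮ z in C(0, r), F z‖ ≤ 2 * Real.pi * C / R := by
      intro R hR
      have hr : r ≤ R := (le_max_left _ _).trans hR
      have h2 : 2 ≤ R := (le_max_right _ _).trans hR
      rw [← heq R hr]
      refine (circleIntegral.norm_integral_le_of_norm_le_const (C := C * (R ^ 2)⁻¹) (by linarith) ?_).trans (le_of_eq ?_)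
      · intro z hz
        have hz' : ‖z‖ = R := by simpa using hz
        have := hC z (by rw [hz']; exact h2)
        rwa [hz'] at this
      · have : R ≠ 0 := by linarith
        field_simp
    have hlim : Filter.Tendsto (fun R : ℝ => 2 * Real.pi * C / R) Filter.atTop (nhds 0) :=
      Filter.Tendsto.const_div_atTop Filter.tendsto_id _
    have := ge_of_tendsto hlim (Filter.eventually_atTop.2 ⟨max r 2, hle⟩)
    exact norm_le_zero_iff.1 this
  rw [key]
  simp

/-- bounds on the winding numbers `nᵢ` and their sum `S` for a nonzero summand
at time `t`. -/
theorem stmt4 (L P : ℕ) (hP : 1 ≤ P) (hPL : P < L)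
    (v : ℝ) (hv0 : 0 < v) (hv1 : v < 1 / 2)
    (r : ℝ) (hr1 : 1 < r) (hr2 : r < 1 / (v / (1 - v)))
    (t : ℕ) (X Y : Fin P → ℤ) (hX : IsConfig L P X) (hY : IsConfig L P Y)
    (σ : Equiv.Perm (Fin P)) (n : Fin P → ℤ)
    (hprod : (∏ i : Fin P, fInt (v / (1 - v)) r
        (((i : ℕ) : ℤ) - ((σ i : ℕ) : ℤ) + (P : ℤ) * n i - ∑ k, n k)
        (X i - Y (σ i) + n i * L) t) ≠ 0) :
    (0 ≤ ∑ k, n k ∧ ∑ k, n k ≤ (t : ℤ)) ∧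
    (L : ℤ) * ∑ k, n k ≤ (P : ℤ) * ((L : ℤ) - (P : ℤ) + (t : ℤ)) ∧
    ∀ i : Fin P,
      (-((L : ℤ) - (P : ℤ)) - ∑ k, n k ≤ ((L : ℤ) - (P : ℤ)) * n i ∧
        ((L : ℤ) - (P : ℤ)) * n i ≤ ((L : ℤ) - (P : ℤ)) + (t : ℤ) - ∑ k, n k) ∧
      (-((L : ℤ) - (P : ℤ)) - (t : ℤ) ≤ ((L : ℤ) - (P : ℤ)) * n i ∧
        ((L : ℤ) - (P : ℤ)) * n i ≤ ((L : ℤ) - (P : ℤ)) + (t : ℤ)) := by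
  set S := ∑ k, n k with hS
  have hPp : (0 : ℤ) < P := by omega
  have hlam : 0 < v / (1 - v) := div_pos hv0 (by linarith)
  have hf := fun i => Finset.prod_ne_zero_iff.1 hprod i (Finset.mem_univ i)
  obtain ⟨xe, x1, x2, x3, x4, x5⟩ := extend L P hP X hX
  obtain ⟨ye, y1, y2, y3, y4, y5⟩ := extend L P hP Y hY
  have yy : ∀ i : Fin P, ye (((σ i : ℕ) : ℤ) - P * n i) = Y (σ i) - L * n i := by
    intro i
    have := y2 ((σ i : ℕ) : ℤ) (-n i)
    rw [y1] at this
    rw [sub_eq_add_neg, ← mul_neg, this]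
    ring
  have main := comb P hP ((L : ℤ) - P) t (fun k => xe k - k) (fun k => ye (k - S) - k) x3
    (by
      intro k l hkl
      have := y3 (show k - S ≤ l - S by linarith)
      simp only at this ⊢
      linarith)
    (by intro k q; simp only [x2]; ring)
    (by
      intro k q
      have : k + P * q - S = (k - S) + P * q := by ring
      simp only [this, y2]
      ring)
    (fun i => ((σ i : ℕ) : ℤ) - P * n i + S)
    (by
      intro c
      have e : ∀ i : Fin P, (((σ i : ℕ) : ℤ) - P * n i + S - c) / (P : ℤ)
          = (((σ i : ℕ) : ℤ) + (S - c)) / (P : ℤ) - n i := by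
        intro i
        have : ((σ i : ℕ) : ℤ) - P * n i + S - c = (((σ i : ℕ) : ℤ) + (S - c)) + P * (-n i) := by ring
        rw [this, Int.add_mul_ediv_left _ _ hPp.ne']
        ring
      simp only [e]
      rw [Finset.sum_sub_distrib, Equiv.sum_comp σ (fun j : Fin P => (((j : ℕ) : ℤ) + (S - c)) / (P : ℤ)),
        hermite P hP, ← hS]
      ring)
    (by
      intro i
      by_contra hc
      push Not at hc
      obtain ⟨c1, c2⟩ := hc
      simp only [add_sub_cancel_right, yy, x1] at c2
      exact hf i (f_zero_in _ _ hlam hr1 hr2 _ _ _ (by linarith) (by linarith)))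
    (by
      intro i
      by_contra hc
      push Not at hc
      obtain ⟨c1, c2⟩ := hc
      simp only [add_sub_cancel_right, yy, x1] at c2
      exact hf i (f_zero_out _ _ hr1 _ _ _ (by linarith) (by linarith)))
  obtain ⟨m1, m2⟩ := main
  simp only [add_sub_cancel_right, yy, x1] at m1
  have hpre : ((P : ℤ) - 1) = -1 + P * 1 := by ring
  have S0 : 0 ≤ S := by
    by_contra hc
    have h := (m2 (P - 1)).1
    have h' := y3 (show (0 : ℤ) + P * 1 ≤ (P : ℤ) - 1 - S by linarith [Int.not_le.1 hc])
    simp only [y2] at h h'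
    push Not at hc
    linarith
  have St : S ≤ t := by
    by_contra hc
    push Not at hc
    have h := (m2 0).2
    have h' := y3 (show (0 : ℤ) - S ≤ -1 by linarith)
    rw [hpre, y2] at y5
    simp only at h h'
    linarith
  have bx : ∀ i : Fin P, 1 ≤ X i - ((i : ℕ) : ℤ) := by
    intro i
    have := x3 (show (0 : ℤ) ≤ ((i : ℕ) : ℤ) by omega)
    simp only [x1] at this
    linarith
  have bx' : ∀ i : Fin P, X i - ((i : ℕ) : ℤ) ≤ L - P + 1 := by
    intro i
    have := x3 (show ((i : ℕ) : ℤ) ≤ (P : ℤ) - 1 by have := i.2; omega)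
    simp only [x1] at this
    linarith
  have bY : ∀ i : Fin P, 1 ≤ Y i - ((i : ℕ) : ℤ) := by
    intro i
    have := y3 (show (0 : ℤ) ≤ ((i : ℕ) : ℤ) by omega)
    simp only [y1] at this
    linarith
  have bY' : ∀ i : Fin P, Y i - ((i : ℕ) : ℤ) ≤ L - P + 1 := by
    intro i
    have := y3 (show ((i : ℕ) : ℤ) ≤ (P : ℤ) - 1 by have := i.2; omega)
    simp only [y1] at this
    linarith
  have lo : ∀ i : Fin P, -((L : ℤ) - (P : ℤ)) - S ≤ ((L : ℤ) - (P : ℤ)) * n i := by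
    intro i
    linarith [(m1 i).1, bx' i, bY (σ i)]
  have up : ∀ i : Fin P, ((L : ℤ) - (P : ℤ)) * n i ≤ ((L : ℤ) - (P : ℤ)) + (t : ℤ) - S := by
    intro i
    linarith [(m1 i).2, bx i, bY' (σ i)]
  refine ⟨⟨S0, St⟩, ?_, fun i => ⟨⟨lo i, up i⟩, by linarith [lo i], by linarith [up i]⟩⟩
  have hs := Finset.sum_le_sum (fun i (_ : i ∈ (Finset.univ : Finset (Fin P))) => up i)
  rw [← Finset.mul_sum, ← hS] at hs
  simp only [Finset.sum_const, Finset.card_univ, Fintype.card_fin, nsmul_eq_mul] at hs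
  linarith
end

section
/- Let 1 ≤ P < L, let X, Y be configurations of P particles on the ring of L sites, let σ be a permutation of {1,…,P}, and let n_1,…,n_P ∈ ℤ. Define a_i = i − σ(i) + P·n_i − (n_1+⋯+n_P) and b_i = x_i − y_{σ(i)} + n_i·L. Assume the admissibility conditions hold: for every i, if a_i ≥ 0 then b_i ≤ a_i, and if a_i ≤ 0 then b_i ≥ a_i. Then n_i ∈ {−1, 0, 1} for every i, and n_1 + ⋯ + n_P = 0. -/
theorem aux_sum (s : Finset ℤ) : ∀ m : ℤ, (∀ x ∈ s, x ≤ m) →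
    2 * ∑ x ∈ s, x ≤ (s.card : ℤ) * (2 * m - s.card + 1) := by
  induction s using Finset.induction_on_max with
  | empty => intro m _; simp
  | insert a s h ih =>
    intro m hm
    have ha : a ∉ s := fun h' => lt_irrefl _ (h a h')
    have h1 := ih (a - 1) (fun x hx => by have := h x hx; omega)
    have h2 : a ≤ m := hm a (Finset.mem_insert_self a s)
    rw [Finset.sum_insert ha, Finset.card_insert_of_notMem ha]
    push_cast
    have h3 : (0 : ℤ) ≤ s.card := by positivity
    nlinarith

theorem aux_inj (P : ℕ) (f : Fin P → ℤ) (hf : Function.Injective f) (m : ℤ)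
    (hm : ∀ i, f i ≤ m) : 2 * ∑ i, f i ≤ (P : ℤ) * (2 * m - P + 1) := by
  have h := aux_sum (Finset.univ.image f) m (by simpa using hm)
  rw [Finset.sum_image (fun x _ y _ h => hf h), Finset.card_image_of_injective _ hf] at h
  simpa using h

theorem aux_lo (L P : ℕ) (X : Fin P → ℤ) (hX : IsConfig L P X) :
    ∀ (k : ℕ) (hk : k < P), 1 + (k : ℤ) ≤ X ⟨k, hk⟩ := by
  intro k
  induction k with
  | zero => intro hk; have := (hX.2 ⟨0, hk⟩).1; simpa using this
  | succ k ih =>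
    intro hk
    have h1 := ih (by omega)
    have h2 : X ⟨k, by omega⟩ < X ⟨k + 1, hk⟩ := hX.1 (by simp [Fin.lt_def])
    push_cast
    omega

theorem aux_hi (L P : ℕ) (X : Fin P → ℤ) (hX : IsConfig L P X) :
    ∀ (d k : ℕ) (hk : k < P), k + d + 1 = P → X ⟨k, hk⟩ ≤ (L : ℤ) - d := by
  intro d
  induction d with
  | zero => intro k hk _; have := (hX.2 ⟨k, hk⟩).2; simpa using this
  | succ d ih =>
    intro k hk h
    have h1 := ih (k + 1) (by omega) (by omega)
    have h2 : X ⟨k, hk⟩ < X ⟨k + 1, by omega⟩ := hX.1 (by simp [Fin.lt_def])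
    push_cast
    omega

theorem aux_bd (L P : ℕ) (X : Fin P → ℤ) (hX : IsConfig L P X) (i : Fin P) :
    1 + ((i : ℕ) : ℤ) ≤ X i ∧ X i ≤ (L : ℤ) - P + 1 + (i : ℕ) := by
  refine ⟨aux_lo L P X hX i i.2, ?_⟩
  have hi := i.2
  have := aux_hi L P X hX (P - 1 - i) i i.2 (by omega)
  simp only [Fin.eta] at this
  omega

theorem aux_sumid (P : ℕ) : 2 * ∑ i : Fin P, ((i : ℕ) : ℤ) = (P : ℤ) * (P - 1) := by
  induction P with
  | zero => simp
  | succ P ih =>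
    rw [Fin.sum_univ_castSucc, mul_add]
    simp only [Fin.val_castSucc, Fin.val_last]
    rw [ih]; push_cast; ring

/-- if the admissibility conditions hold for `aᵢ = i - σ(i) + Pnᵢ - Σn` and
`bᵢ = xᵢ - y_{σ(i)} + nᵢL` (namely `aᵢ ≥ 0 → bᵢ ≤ aᵢ` and `aᵢ ≤ 0 → bᵢ ≥ aᵢ`), then each
`nᵢ ∈ {-1,0,1}` and `Σnᵢ = 0`. -/
theorem stmt6 (L P : ℕ) (hP : 1 ≤ P) (hPL : P < L) (X Y : Fin P → ℤ)
    (hX : IsConfig L P X) (hY : IsConfig L P Y)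
    (σ : Equiv.Perm (Fin P)) (n : Fin P → ℤ)
    (hadm : ∀ i : Fin P,
      (0 ≤ ((i : ℕ) : ℤ) - ((σ i : ℕ) : ℤ) + (P : ℤ) * n i - ∑ k, n k →
        X i - Y (σ i) + n i * L ≤
          ((i : ℕ) : ℤ) - ((σ i : ℕ) : ℤ) + (P : ℤ) * n i - ∑ k, n k) ∧
      (((i : ℕ) : ℤ) - ((σ i : ℕ) : ℤ) + (P : ℤ) * n i - ∑ k, n k ≤ 0 →
        ((i : ℕ) : ℤ) - ((σ i : ℕ) : ℤ) + (P : ℤ) * n i - ∑ k, n k ≤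
          X i - Y (σ i) + n i * L)) :
    (∀ i, n i = -1 ∨ n i = 0 ∨ n i = 1) ∧ ∑ i, n i = 0 := by
  have hP0 : (0 : ℤ) < P := by exact_mod_cast hP
  have hM : (P : ℤ) < L := by exact_mod_cast hPL
  have hXb := aux_bd L P X hX
  have hYb := aux_bd L P Y hY
  obtain ⟨N, hN⟩ : ∃ N, N = ∑ k, n k := ⟨_, rfl⟩
  rw [← hN] at hadm ⊢
  have hinj : Function.Injective (fun i : Fin P => ((i : ℕ) : ℤ) + P * n i - N) := by
    intro i j hij
    have hij' : ((i : ℕ) : ℤ) + P * n i = ((j : ℕ) : ℤ) + P * n j := by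
      simp only at hij; omega
    have h := congrArg (fun z : ℤ => z % (P : ℤ)) hij'
    simp only [Int.add_mul_emod_self_left] at h
    have hi := i.2
    have hj := j.2
    rw [Int.emod_eq_of_lt (by omega) (by omega), Int.emod_eq_of_lt (by omega) (by omega)] at h
    exact Fin.ext (by exact_mod_cast h)
  have hsum : 2 * ∑ i : Fin P, (((i : ℕ) : ℤ) + P * n i - N) = (P : ℤ) * (P - 1) := by
    rw [Finset.sum_sub_distrib, Finset.sum_add_distrib, ← Finset.mul_sum, ← hN, ← aux_sumid]
    simp
  have hN0 : N = 0 := by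
    rcases lt_trichotomy N 0 with h | h | h
    · exfalso
      obtain ⟨i, hi⟩ : ∃ i : Fin P, ((i : ℕ) : ℤ) + P * n i - N ≤ 0 := by
        by_contra! hc
        have h1 := aux_inj P (fun i : Fin P => -(((i : ℕ) : ℤ) + P * n i - N))
          (fun a b hab => hinj (neg_injective hab)) (-1)
          (fun i => by have := hc i; omega)
        rw [Finset.sum_neg_distrib] at h1
        nlinarith
      have h2 := (hadm i).2 (by omega)
      have := hXb i
      have := hYb (σ i)
      have h3 : n i ≤ -1 := by
        by_contra! hc
        have : 0 ≤ (P : ℤ) * n i := mul_nonneg hP0.le (by omega)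
        omega
      nlinarith
    · exact h
    · exfalso
      obtain ⟨i, hi⟩ : ∃ i : Fin P, (P : ℤ) - 1 ≤ ((i : ℕ) : ℤ) + P * n i - N := by
        by_contra! hc
        have h1 := aux_inj P _ hinj (P - 2) (fun i => by have := hc i; omega)
        nlinarith
      have hs := (σ i).2
      have hi2 := i.2
      have h2 := (hadm i).1 (by omega)
      have := hXb i
      have := hYb (σ i)
      have h3 : 1 ≤ n i := by
        by_contra! hc
        have : (P : ℤ) * n i ≤ 0 := mul_nonpos_of_nonneg_of_nonpos hP0.le (by omega)
        omega
      nlinarith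
  refine ⟨fun i => ?_, hN0⟩
  subst hN0
  have hs := (σ i).2
  have hi2 := i.2
  have := hXb i
  have := hYb (σ i)
  have hlo : -1 ≤ n i := by
    by_contra! hc
    have h1 : (P : ℤ) * n i ≤ P * (-2) := mul_le_mul_of_nonneg_left (by omega) hP0.le
    have h2 := (hadm i).2 (by omega)
    nlinarith
  have hhi : n i ≤ 1 := by
    by_contra! hc
    have h1 : (P : ℤ) * 2 ≤ P * n i := mul_le_mul_of_nonneg_left (by omega) hP0.le
    have h2 := (hadm i).1 (by omega)
    nlinarith
  omega
end

section
/- Let 1 ≤ P < L, let X, Y be configurations of P particles on the ring of L sites, let σ be a permutation of {1,…,P}, and let n ∈ ℤ. Suppose that for every i, setting a_i = i − σ(i) and b_i = x_i − y_{σ(i)} + n·L, the admissibility conditions hold: if a_i ≥ 0 then b_i ≤ a_i, and if a_i ≤ 0 then b_i ≥ a_i. Then n = 0. (This is the case of equal winding numbers n_1 = … = n_P = n.) -/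
theorem cfg_lower {L P : ℕ} {X : Fin P → ℤ} (h : IsConfig L P X) :
    ∀ (k : ℕ) (hk : k < P), (k : ℤ) + 1 ≤ X ⟨k, hk⟩ := by
  intro k
  induction k with
  | zero => intro hk; have := (h.2 ⟨0, hk⟩).1; simpa using this
  | succ k ih =>
    intro hk
    have h1 := ih (by omega)
    have h2 : X ⟨k, by omega⟩ < X ⟨k + 1, hk⟩ := h.1 (by simp [Fin.lt_def])
    push_cast
    omega

theorem cfg_upper {L P : ℕ} {X : Fin P → ℤ} (h : IsConfig L P X) :
    ∀ (d k : ℕ) (hk : k < P), k + d + 1 = P → X ⟨k, hk⟩ ≤ (L : ℤ) - d := by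
  intro d
  induction d with
  | zero => intro k hk _; have := (h.2 ⟨k, hk⟩).2; simpa using this
  | succ d ih =>
    intro k hk e
    have h1 := ih (k + 1) (by omega) (by omega)
    have h2 : X ⟨k, hk⟩ < X ⟨k + 1, by omega⟩ := h.1 (by simp [Fin.lt_def])
    push_cast
    omega

/-- equal winding numbers `n₁ = ⋯ = n_P = n`: if for every `i`, with
`aᵢ = i - σ(i)` and `bᵢ = xᵢ - y_{σ(i)} + nL`, one has (`aᵢ ≥ 0 → bᵢ ≤ aᵢ`) and
(`aᵢ ≤ 0 → bᵢ ≥ aᵢ`), then `n = 0`. -/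
theorem stmt8 (L P : ℕ) (hP : 1 ≤ P) (hPL : P < L) (X Y : Fin P → ℤ)
    (hX : IsConfig L P X) (hY : IsConfig L P Y) (σ : Equiv.Perm (Fin P)) (n : ℤ)
    (hadm : ∀ i : Fin P,
      (0 ≤ ((i : ℕ) : ℤ) - ((σ i : ℕ) : ℤ) →
        X i - Y (σ i) + n * L ≤ ((i : ℕ) : ℤ) - ((σ i : ℕ) : ℤ)) ∧
      (((i : ℕ) : ℤ) - ((σ i : ℕ) : ℤ) ≤ 0 →
        ((i : ℕ) : ℤ) - ((σ i : ℕ) : ℤ) ≤ X i - Y (σ i) + n * L)) :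
    n = 0 := by
  have hlt0 : 0 < P := hP
  have hltl : P - 1 < P := by omega
  have hLpos : (0 : ℤ) < L := by omega
  have hup : n ≤ 0 := by
    obtain ⟨i, hi⟩ := σ.surjective ⟨0, hlt0⟩
    have h1 := (hadm i).1
    rw [hi] at h1
    have h2 := cfg_lower hX i i.2
    have h3 := cfg_upper hY (P - 1) 0 hlt0 (by omega)
    have h4 := h1 (by simp)
    simp only [Fin.eta] at h2 
    push_cast at h4
    have : n * L < 1 * L := by omega
    have := lt_of_mul_lt_mul_right this hLpos.le
    omega
  have hlo : 0 ≤ n := by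
    obtain ⟨i, hi⟩ := σ.surjective ⟨P - 1, hltl⟩
    have h1 := (hadm i).2
    rw [hi] at h1
    have hi2 := i.2
    have h2 := cfg_upper hX (P - 1 - i) i i.2 (by omega)
    have h3 := cfg_lower hY (P - 1) hltl
    simp only [Fin.eta] at h2
    simp only at h1
    have h4 := h1 (by omega)
    have : (-1) * (L : ℤ) < n * L := by omega
    have := lt_of_mul_lt_mul_right this hLpos.le
    omega
  omega
end

section
/- Let P ≥ 1, let n_1,…,n_P ∈ ℤ with S = n_1+⋯+n_P, and let σ be a permutation of {1,…,P}. Then there exists an index i with n_i = max{n_1,…,n_P} and i − σ(i) + P·n_i − S ≥ 0, and there exists an index j with n_j = min{n_1,…,n_P} and j − σ(j) + P·n_j − S ≤ 0. -/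
/-- for integers `n₁,…,n_P` with sum `S` and a permutation `σ`, there is an index
`i` attaining the maximum of the `nⱼ` with `i - σ(i) + P·nᵢ - S ≥ 0`, and an index attaining
the minimum with `i - σ(i) + P·nᵢ - S ≤ 0`. -/
theorem stmt9 (P : ℕ) (hP : 1 ≤ P) (n : Fin P → ℤ) (σ : Equiv.Perm (Fin P)) :
    (∃ i : Fin P, (∀ j, n j ≤ n i) ∧
      0 ≤ ((i : ℕ) : ℤ) - ((σ i : ℕ) : ℤ) + (P : ℤ) * n i - ∑ k, n k) ∧
    (∃ i : Fin P, (∀ j, n i ≤ n j) ∧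
      ((i : ℕ) : ℤ) - ((σ i : ℕ) : ℤ) + (P : ℤ) * n i - ∑ k, n k ≤ 0) := by
  haveI : Nonempty (Fin P) := ⟨⟨0, hP⟩⟩
  constructor
  · obtain ⟨m, hm⟩ := Finite.exists_max n
    obtain ⟨i, hi, hmax⟩ := Finset.exists_max_image
      (Finset.univ.filter fun i => n i = n m) (fun i => i) ⟨m, by simp⟩
    simp only [Finset.mem_filter, Finset.mem_univ, true_and] at hi hmax
    refine ⟨i, fun j => hi ▸ hm j, ?_⟩
    have h : ∑ k : Fin P, (if k ∈ Finset.Ioi i then (1 : ℤ) else 0) ≤ ∑ k, (n i - n k) := by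
      apply Finset.sum_le_sum
      intro k _
      have h1 := hm k
      split_ifs with hk
      · have h2 : n k ≠ n m := fun h => absurd (hmax k h) (not_le.mpr (Finset.mem_Ioi.mp hk))
        omega
      · omega
    rw [Finset.sum_ite_mem, Finset.univ_inter, Finset.sum_const, Fin.card_Ioi,
      Finset.sum_sub_distrib, Finset.sum_const, Finset.card_univ, Fintype.card_fin] at h
    simp only [nsmul_eq_mul, mul_one] at h
    have h1 := i.2
    have h2 := (σ i).2
    omega
  · obtain ⟨m, hm⟩ := Finite.exists_min n
    obtain ⟨i, hi, hmin⟩ := Finset.exists_min_image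
      (Finset.univ.filter fun i => n i = n m) (fun i => i) ⟨m, by simp⟩
    simp only [Finset.mem_filter, Finset.mem_univ, true_and] at hi hmin
    refine ⟨i, fun j => hi ▸ hm j, ?_⟩
    have h : ∑ k : Fin P, (if k ∈ Finset.Iio i then (1 : ℤ) else 0) ≤ ∑ k, (n k - n i) := by
      apply Finset.sum_le_sum
      intro k _
      have h1 := hm k
      split_ifs with hk
      · have h2 : n k ≠ n m := fun h => absurd (hmin k h) (not_le.mpr (Finset.mem_Iio.mp hk))
        omega
      · omega
    rw [Finset.sum_ite_mem, Finset.univ_inter, Finset.sum_const, Fin.card_Iio,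
      Finset.sum_sub_distrib, Finset.sum_const, Finset.card_univ, Fintype.card_fin] at h
    simp only [nsmul_eq_mul, mul_one] at h
    omega
end

section
/- Let 1 ≤ P < L, let X, Y be configurations of P particles on the ring of L sites, let σ be a permutation of {1,…,P}, and let n_1,…,n_P ∈ ℤ with S = n_1+⋯+n_P. Define a_i = i − σ(i) + P·n_i − S and b_i = x_i − y_{σ(i)} + n_i·L, and assume for every i: if a_i ≥ 0 then b_i ≤ a_i, and if a_i ≤ 0 then b_i ≥ a_i. Then for every i, −(L−P) − S ≤ (L−P)·n_i ≤ (L−P) − S. -/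
theorem cfg_gap (P : ℕ) (X : Fin P → ℤ) (hX : StrictMono X) (i : Fin P) :
    ∀ d : ℕ, ∀ h : i.val + d < P, X i + d ≤ X ⟨i.val + d, h⟩ := by
  intro d
  induction d with
  | zero => intro h; simp
  | succ d ih =>
    intro h
    have h1 := ih (by omega)
    have h2 : X ⟨i.val + d, by omega⟩ < X ⟨i.val + (d + 1), h⟩ := hX (by
      simp [Fin.lt_def])
    push_cast
    omega

theorem cfg_bd (L P : ℕ) (X : Fin P → ℤ) (hX : IsConfig L P X) (i : Fin P) :
    1 ≤ X i - ((i : ℕ) : ℤ) ∧ X i - ((i : ℕ) : ℤ) ≤ (L : ℤ) - P + 1 := by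
  have hi := i.isLt
  have h1 := cfg_gap P X hX.1 ⟨0, by omega⟩ i.val (by simp)
  have h2 := cfg_gap P X hX.1 i (P - 1 - i.val) (by omega)
  have h3 := (hX.2 ⟨0, by omega⟩).1
  have h4 := (hX.2 ⟨i.val + (P - 1 - i.val), by omega⟩).2
  simp only [zero_add, Fin.eta] at h1
  omega

theorem cnt (P : ℕ) (σ : Equiv.Perm (Fin P)) (n : Fin P → ℤ) (r : ℤ)
    (hn : ∀ k, n k ≤ 1) (hs : ∑ k, n k = r)
    (h : ∀ k, n k = 1 → (P : ℤ) - r < ((σ k : ℕ) : ℤ)) (i : Fin P) (hi : n i = 1) : False := by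
  have hr := h i hi
  have hl := (σ i).isLt
  have e : ∑ k, n k ≤ ∑ k, (if (P : ℤ) - r < ((σ k : ℕ) : ℤ) then (1 : ℤ) else 0) := by
    apply Finset.sum_le_sum
    intro k _
    have := hn k
    have := h k
    split_ifs <;> omega
  rw [Equiv.sum_comp σ (fun k : Fin P => if (P : ℤ) - r < ((k : ℕ) : ℤ) then (1 : ℤ) else 0),
    Finset.sum_boole] at e
  have c : (Finset.univ.filter (fun k : Fin P => (P : ℤ) - r < ((k : ℕ) : ℤ))).card
      ≤ (Finset.Ioo ((P : ℤ) - r) P).card := by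
    apply Finset.card_le_card_of_injOn (fun k : Fin P => ((k : ℕ) : ℤ))
    · intro k hk
      have := k.isLt
      simp at hk ⊢
      omega
    · intro a _ b _ hab
      apply Fin.ext
      simpa using hab
  rw [Int.card_Ioo] at c
  omega

/-- under the admissibility conditions for `aᵢ = i - σ(i) + Pnᵢ - S` and
`bᵢ = xᵢ - y_{σ(i)} + nᵢL`, one has `-(L-P) - S ≤ (L-P)·nᵢ ≤ (L-P) - S` for every `i`. -/
theorem stmt10 (L P : ℕ) (hP : 1 ≤ P) (hPL : P < L) (X Y : Fin P → ℤ)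
    (hX : IsConfig L P X) (hY : IsConfig L P Y)
    (σ : Equiv.Perm (Fin P)) (n : Fin P → ℤ)
    (hadm : ∀ i : Fin P,
      (0 ≤ ((i : ℕ) : ℤ) - ((σ i : ℕ) : ℤ) + (P : ℤ) * n i - ∑ k, n k →
        X i - Y (σ i) + n i * L ≤
          ((i : ℕ) : ℤ) - ((σ i : ℕ) : ℤ) + (P : ℤ) * n i - ∑ k, n k) ∧
      (((i : ℕ) : ℤ) - ((σ i : ℕ) : ℤ) + (P : ℤ) * n i - ∑ k, n k ≤ 0 →
        ((i : ℕ) : ℤ) - ((σ i : ℕ) : ℤ) + (P : ℤ) * n i - ∑ k, n k ≤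
          X i - Y (σ i) + n i * L)) :
    ∀ i : Fin P,
      -((L : ℤ) - (P : ℤ)) - ∑ k, n k ≤ ((L : ℤ) - (P : ℤ)) * n i ∧
      ((L : ℤ) - (P : ℤ)) * n i ≤ ((L : ℤ) - (P : ℤ)) - ∑ k, n k := by
  have hD : (0 : ℤ) < (L : ℤ) - P := by omega
  have hne : (Finset.univ : Finset (Fin P)).Nonempty := ⟨⟨0, by omega⟩, Finset.mem_univ _⟩
  generalize hS : ∑ k, n k = S at hadm ⊢
  intro i
  constructor
  · by_contra hcon
    obtain ⟨j, -, hj⟩ := Finset.exists_min_image Finset.univ n hne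
    have hji : n j ≤ n i := hj i (Finset.mem_univ _)
    have hmul := mul_le_mul_of_nonneg_left hji hD.le
    refine cnt P (σ.trans Fin.revPerm) (fun k => n j + 1 - n k) (P * (n j + 1) - S) ?_ ?_ ?_ j ?_
    · intro k
      have := hj k (Finset.mem_univ _)
      omega
    · simp [Finset.sum_sub_distrib, hS]
    · intro k hk
      have hk' : n k = n j := by omega
      have h2 := (hadm k).2
      have hx := cfg_bd L P X hX k
      have hy := cfg_bd L P Y hY (σ k)
      have hk1 := k.isLt
      have hk2 := (σ k).isLt
      rw [hk'] at h2
      have ha : ¬ (((k : ℕ) : ℤ) - ((σ k : ℕ) : ℤ) + (P : ℤ) * n j - S ≤ 0) := by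
        intro h
        have := h2 h
        nlinarith
      have e : (((σ.trans Fin.revPerm) k : Fin P) : ℕ) = P - (σ k + 1) := by
        simp [Fin.val_rev]
      rw [e, mul_add, mul_one]
      omega
    · simp
  · by_contra hcon
    obtain ⟨j, -, hj⟩ := Finset.exists_max_image Finset.univ n hne
    have hji : n i ≤ n j := hj i (Finset.mem_univ _)
    have hmul := mul_le_mul_of_nonneg_left hji hD.le
    refine cnt P σ (fun k => n k - (n j - 1)) (S - P * (n j - 1)) ?_ ?_ ?_ j ?_
    · intro k
      have := hj k (Finset.mem_univ _)
      omega
    · rw [Finset.sum_sub_distrib, hS]; simp; ring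
    · intro k hk
      have hk' : n k = n j := by omega
      have h2 := (hadm k).1
      have hx := cfg_bd L P X hX k
      have hy := cfg_bd L P Y hY (σ k)
      rw [hk'] at h2
      have ha : ¬ (0 ≤ ((k : ℕ) : ℤ) - ((σ k : ℕ) : ℤ) + (P : ℤ) * n j - S) := by
        intro h
        have := h2 h
        nlinarith
      rw [mul_sub, mul_one]
      omega
    · simp
end

section
/- Let 1 ≤ P < L and let X, Y be configurations of P particles on the ring of L sites. Suppose that for some indices 1 ≤ i, j ≤ P one has (y_j − x_i) − (j − i) = L − P. Then x_k = k for all 1 ≤ k ≤ i and y_k = L − P + k for all j ≤ k ≤ P; in particular x_1 = 1 and y_P = L, so X has a cluster starting at site 1 and Y has a cluster ending at site L. -/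
theorem gap_aux {P : ℕ} (X : Fin P → ℤ) (hX : StrictMono X) (d : ℕ) :
    ∀ a b : Fin P, (b : ℕ) = (a : ℕ) + d → X a + (d : ℤ) ≤ X b := by
  induction d with
  | zero =>
    intro a b hab
    have : a = b := Fin.ext (by omega)
    subst this
    simp
  | succ d ih =>
    intro a b hab
    have hb := b.isLt
    have h1 := ih a ⟨(a : ℕ) + d, by omega⟩ rfl
    have h2 : X ⟨(a : ℕ) + d, by omega⟩ < X b := hX (by rw [Fin.lt_def]; simp only; omega)
    push_cast
    linarith

theorem gap_le {P : ℕ} (X : Fin P → ℤ) (hX : StrictMono X) (a b : Fin P) (hab : a ≤ b) :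
    X a + ((b : ℕ) : ℤ) - ((a : ℕ) : ℤ) ≤ X b := by
  have h := gap_aux X hX ((b : ℕ) - (a : ℕ)) a b (by rw [Fin.le_def] at hab; omega)
  rw [Fin.le_def] at hab
  omega

/-- if `(yⱼ - xᵢ) - (j - i) = L - P` then `x_k = k` for all `k ≤ i` and
`y_k = L - P + k` for all `k ≥ j` (indices written `1`-based); in particular `x₁ = 1` and
`y_P = L`. -/
theorem stmt11 (L P : ℕ) (hP : 1 ≤ P) (hPL : P < L) (X Y : Fin P → ℤ)
    (hX : IsConfig L P X) (hY : IsConfig L P Y) (i j : Fin P)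
    (h : (Y j - X i) - (((j : ℕ) : ℤ) - ((i : ℕ) : ℤ)) = (L : ℤ) - (P : ℤ)) :
    (∀ k : Fin P, k ≤ i → X k = ((k : ℕ) : ℤ) + 1) ∧
    (∀ k : Fin P, j ≤ k → Y k = (L : ℤ) - (P : ℤ) + (((k : ℕ) : ℤ) + 1)) ∧
    X ⟨0, hP⟩ = 1 ∧ Y ⟨P - 1, by omega⟩ = L := by
  have lo : ∀ k : Fin P, ((k : ℕ) : ℤ) + 1 ≤ X k := by
    intro k
    have h1 := gap_le X hX.1 ⟨0, hP⟩ k (by rw [Fin.le_def]; simp)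
    have h2 := (hX.2 ⟨0, hP⟩).1
    simp only [Nat.cast_zero] at h1
    linarith
  have hi : ∀ k, Y k ≤ (L : ℤ) - (P : ℤ) + (((k : ℕ) : ℤ) + 1) := by
    intro k
    have hk := k.isLt
    have h1 := gap_le Y hY.1 k ⟨P - 1, by omega⟩ (by rw [Fin.le_def]; simp only; omega)
    have h2 := (hY.2 ⟨P - 1, by omega⟩).2
    simp only [Nat.cast_sub hP, Nat.cast_one] at h1
    linarith
  have hi' := hi j
  have lo' := lo i
  have A : ∀ k : Fin P, k ≤ i → X k = ((k : ℕ) : ℤ) + 1 := by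
    intro k hk
    have h1 := gap_le X hX.1 k i hk
    have h2 := lo k
    linarith
  have B : ∀ k : Fin P, j ≤ k → Y k = (L : ℤ) - (P : ℤ) + (((k : ℕ) : ℤ) + 1) := by
    intro k hk
    have h1 := gap_le Y hY.1 j k hk
    have h2 := hi k
    linarith
  refine ⟨A, B, ?_, ?_⟩
  · have := A ⟨0, hP⟩ (by rw [Fin.le_def]; simp)
    simpa using this
  · have hj := j.isLt
    have := B ⟨P - 1, by omega⟩ (by rw [Fin.le_def]; simp only; omega)
    simp only [Nat.cast_sub hP, Nat.cast_one] at this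
    linarith
end

section
/- Let 0 < v < 1/2, λ = v/(1−v), and 1 < r < 1/λ. For integers a, b and a nonnegative integer t the function f satisfies: (i) if a ≥ 0 and b > a + t then f(a,b,t) = 0; (ii) if a ≤ 0 and b < a then f(a,b,t) = 0; (iii) f(0,b,t) = (1+λ)^{−t} · binom(t,b) · λ^b for 0 ≤ b ≤ t, and f(0,b,t) = 0 for b < 0 or b > t. -/
open Classical

open Complex in
lemma aux_ii (lam r : ℝ) (h0 : 0 < lam) (hr1 : 1 < r) (hr : lam * r < 1) (a b : ℤ) (t : ℕ)
    (ha : a ≤ 0) (hb : b < a) : fInt lam r a b t = 0 := by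
  unfold fInt
  have : (∮ z in C(0, r), (1 + (lam : ℂ) * z) ^ ((t : ℤ) + a) * (z - 1) ^ (-a) * z ^ (a - b - 1)) = 0 := by
    have hne : ∀ z ∈ Metric.closedBall (0:ℂ) r, 1 + (lam : ℂ) * z ≠ 0 := by
      intro z hz h
      have h1 : (lam : ℂ) * z = -1 := by linear_combination h
      have h2 := congrArg norm h1
      rw [norm_mul, norm_neg, norm_one, Complex.norm_real, Real.norm_of_nonneg h0.le] at h2
      have h3 : ‖z‖ ≤ r := by simpa using hz
      nlinarith
    have hd : ∀ z ∈ Metric.closedBall (0:ℂ) r, DifferentiableAt ℂ (fun z : ℂ => (1 + (lam : ℂ) * z) ^ ((t : ℤ) + a) * (z - 1) ^ (-a) * z ^ (a - b - 1)) z := by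
      intro z hz
      refine DifferentiableAt.mul (DifferentiableAt.mul ?_ ?_) ?_
      · exact DifferentiableAt.zpow (by fun_prop) (Or.inl (hne z hz))
      · exact DifferentiableAt.zpow (by fun_prop) (Or.inr (by omega))
      · exact DifferentiableAt.zpow (by fun_prop) (Or.inr (by omega))
    refine Complex.circleIntegral_eq_zero_of_differentiable_on_off_countable (by linarith)
      Set.countable_empty (fun z hz => (hd z hz).continuousAt.continuousWithinAt) ?_
    intro z hz
    exact hd z (Metric.ball_subset_closedBall hz.1)
  rw [this]; simp

lemma aux_i (lam r : ℝ) (h0 : 0 < lam) (h1 : lam < 1) (hr1 : 1 < r) (a b : ℤ) (t : ℕ)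
    (ha : 0 ≤ a) (hb : a + (t : ℤ) < b) : fInt lam r a b t = 0 := by
  unfold fInt
  obtain ⟨n, rfl⟩ := Int.eq_ofNat_of_zero_le ha
  obtain ⟨k, hk⟩ := Int.eq_ofNat_of_zero_le (show 0 ≤ b - (n + t + 1) by omega)
  set F : ℂ → ℂ := fun z => (1 + (lam : ℂ) * z) ^ ((t : ℤ) + n) * (z - 1) ^ (-(n:ℤ)) * z ^ ((n:ℤ) - b - 1) with hF
  have hFe : ∀ z, F z = (1 + (lam : ℂ) * z) ^ (t + n) * ((z - 1) ^ n)⁻¹ * (z ^ (t + k + 2))⁻¹ := by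
    intro z
    have e1 : (n:ℤ) - b - 1 = -((t + k + 2 : ℕ) : ℤ) := by push_cast; omega
    have e2 : (t:ℤ) + n = ((t + n : ℕ) : ℤ) := by push_cast; rfl
    simp only [hF]
    rw [e1, e2, zpow_neg, zpow_neg, zpow_natCast, zpow_natCast, zpow_natCast]
  have hd : ∀ z : ℂ, r ≤ ‖z‖ → DifferentiableAt ℂ F z := by
    intro z hz
    have hz0 : z ≠ 0 := by rintro rfl; simp at hz; linarith
    have hz1 : z - 1 ≠ 0 := by
      intro h
      have : z = 1 := by linear_combination h
      rw [this] at hz; simp at hz; linarith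
    refine DifferentiableAt.mul (DifferentiableAt.mul ?_ ?_) ?_
    · exact DifferentiableAt.zpow (by fun_prop) (Or.inr (by omega))
    · exact DifferentiableAt.zpow (by fun_prop) (Or.inl hz1)
    · exact DifferentiableAt.zpow (by fun_prop) (Or.inl hz0)
  have heq : ∀ R, r ≤ R → (∮ z in C(0, R), F z) = ∮ z in C(0, r), F z := by
    intro R hR
    refine Complex.circleIntegral_eq_of_differentiable_on_annulus_off_countable (by linarith) hR
      Set.countable_empty ?_ ?_
    · intro z hz
      exact (hd z (by simpa using hz.2)).continuousAt.continuousWithinAt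
    · intro z hz
      refine hd z ?_
      have := hz.1.2
      simp at this
      exact this.le
  set C : ℝ := 2 ^ (t + n) * 2 ^ n with hC
  have hCpos : 0 < C := by positivity
  have hbound : ∀ R, r ≤ R → 2 ≤ R → ‖∮ z in C(0, r), F z‖ ≤ 2 * Real.pi * C / R := by
    intro R hR hR2
    rw [← heq R hR]
    have hRp : 0 < R := by linarith
    have := circleIntegral.norm_integral_le_of_norm_le_const (f := F) (c := 0) (R := R)
      (C := C / R ^ 2) hRp.le ?_
    · refine this.trans (le_of_eq ?_)
      field_simp
    · intro z hz
      have hz : ‖z‖ = R := by simpa using hz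
      rw [hFe, norm_mul, norm_mul, norm_inv, norm_inv, norm_pow, norm_pow, norm_pow, hz]
      have b1 : ‖1 + (lam : ℂ) * z‖ ≤ 2 * R := by
        refine (norm_add_le _ _).trans ?_
        rw [norm_mul, norm_one, Complex.norm_real, Real.norm_of_nonneg h0.le, hz]
        nlinarith
      have b2 : R / 2 ≤ ‖z - 1‖ := by
        have := norm_sub_norm_le z 1
        rw [hz, norm_one] at this
        linarith
      calc _ ≤ (2 * R) ^ (t + n) * ((R / 2) ^ n)⁻¹ * (R ^ (t + k + 2))⁻¹ := by gcongr
        _ = C / R ^ 2 * (R ^ k)⁻¹ := by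
          rw [hC, mul_pow, div_pow]; field_simp; ring
        _ ≤ C / R ^ 2 * 1 := by
          gcongr
          exact inv_le_one_of_one_le₀ (one_le_pow₀ (by linarith))
        _ = _ := mul_one _
  have hz : (∮ z in C(0, r), F z) = 0 := by
    rw [← norm_le_zero_iff]
    refine ge_of_tendsto (f := fun R : ℝ => 2 * Real.pi * C / R) (x := Filter.atTop)
      (tendsto_const_nhds.div_atTop Filter.tendsto_id) ?_
    filter_upwards [Filter.eventually_ge_atTop r, Filter.eventually_ge_atTop 2] with R h h'
    exact hbound R h h'
  rw [hz]; simp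

lemma aux_iii (lam r : ℝ) (hr1 : 1 < r) (b t : ℕ) (hb : b ≤ t) :
    fInt lam r 0 b t = ((1 : ℂ) + (lam : ℂ)) ^ (-(t : ℤ)) * (t.choose b : ℂ) * (lam : ℂ) ^ b := by
  unfold fInt
  have hr : 0 < r := by linarith
  have h1 : (∮ z in C(0, r), (1 + (lam : ℂ) * z) ^ ((t : ℤ) + 0) * (z - 1) ^ (-(0:ℤ)) * z ^ ((0:ℤ) - b - 1))
      = ∮ z in C(0, r), ∑ m ∈ Finset.range (t + 1), ((lam : ℂ) ^ m * t.choose m) * (z - 0) ^ ((m : ℤ) - b - 1) := by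
    refine circleIntegral.integral_congr hr.le ?_
    intro z hz
    have hz0 : z ≠ 0 := by
      rintro rfl
      simp at hz; linarith
    simp only [add_zero, neg_zero, zpow_zero, mul_one, sub_zero, zpow_natCast]
    rw [add_comm, add_pow, Finset.sum_mul]
    refine Finset.sum_congr rfl fun m _ => ?_
    rw [show (m:ℤ) - b - 1 = m + (0 - b - 1) by ring, zpow_add₀ hz0, zpow_natCast]
    ring
  have h2 : ∀ m : ℕ, (∮ z in C(0, r), ((lam : ℂ) ^ m * t.choose m) * (z - 0) ^ ((m : ℤ) - b - 1))
      = if m = b then (lam : ℂ) ^ b * t.choose b * (2 * Real.pi * Complex.I) else 0 := by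
    intro m
    rw [circleIntegral.integral_const_mul]
    split_ifs with h
    · subst h
      simp only [sub_self, zero_sub, zpow_neg_one]
      rw [circleIntegral.integral_sub_center_inv _ hr.ne']
    · rw [circleIntegral.integral_sub_zpow_of_ne (by omega), mul_zero]
  have h3 : (∮ z in C(0, r), ∑ m ∈ Finset.range (t + 1), ((lam : ℂ) ^ m * t.choose m) * (z - 0) ^ ((m : ℤ) - b - 1)) = (lam : ℂ) ^ b * t.choose b * (2 * Real.pi * Complex.I) := by
    rw [circleIntegral.integral_fun_sum]
    · simp only [h2]
      rw [Finset.sum_ite_eq' , if_pos (by simp; omega)]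
    · intro m _
      refine ContinuousOn.circleIntegrable hr.le ?_
      refine continuousOn_const.mul (ContinuousOn.zpow₀ (by fun_prop) _ ?_)
      intro z hz
      left
      rw [sub_zero]
      rintro rfl
      simp at hz; linarith
  rw [h1, h3]
  have := Complex.two_pi_I_ne_zero
  field_simp

/-- vanishing and explicit values of `f(a,b,t)`:
(i) `f(a,b,t) = 0` for `a ≥ 0`, `b > a + t`; (ii) `f(a,b,t) = 0` for `a ≤ 0`, `b < a`;
(iii) `f(0,b,t) = (1+λ)^{-t} C(t,b) λ^b` for `0 ≤ b ≤ t` and `f(0,b,t) = 0` otherwise. -/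
theorem stmt18 (v : ℝ) (hv0 : 0 < v) (hv1 : v < 1 / 2)
    (r : ℝ) (hr1 : 1 < r) (hr2 : r < 1 / (v / (1 - v))) :
    (∀ (a b : ℤ) (t : ℕ), 0 ≤ a → a + (t : ℤ) < b → fInt (v / (1 - v)) r a b t = 0) ∧
    (∀ (a b : ℤ) (t : ℕ), a ≤ 0 → b < a → fInt (v / (1 - v)) r a b t = 0) ∧
    (∀ (b : ℤ) (t : ℕ), 0 ≤ b → b ≤ (t : ℤ) →
      fInt (v / (1 - v)) r 0 b t =
        ((1 : ℂ) + ((v / (1 - v) : ℝ) : ℂ)) ^ (-(t : ℤ)) *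
          (t.choose b.toNat : ℂ) * ((v / (1 - v) : ℝ) : ℂ) ^ b) ∧
    (∀ (b : ℤ) (t : ℕ), b < 0 ∨ (t : ℤ) < b → fInt (v / (1 - v)) r 0 b t = 0) := by
  have h1v : 0 < 1 - v := by linarith
  have h0 : 0 < v / (1 - v) := by positivity
  have h1 : v / (1 - v) < 1 := by rw [div_lt_one h1v]; linarith
  have hr : v / (1 - v) * r < 1 := by
    rw [lt_div_iff₀ h0] at hr2; linarith
  generalize v / (1 - v) = lam at *
  refine ⟨fun a b t => aux_i lam r h0 h1 hr1 a b t, fun a b t => aux_ii lam r h0 hr1 hr a b t, ?_, ?_⟩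
  · intro b t hb hbt
    obtain ⟨n, rfl⟩ := Int.eq_ofNat_of_zero_le hb
    have := aux_iii lam r hr1 n t (by omega)
    simpa using this
  · rintro b t (h | h)
    · exact aux_ii lam r h0 hr1 hr 0 b t le_rfl h
    · exact aux_i lam r h0 h1 hr1 0 b t le_rfl (by omega)
end
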